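/- arXiv:1903.10618 — 2 statements merged into one kernel-verified Lean document; each statement's English description precedes it below -/
import Mathlib

section
/- Let k > 2 and let m = (ln(2)·2^k − x)·n where x < ln(2)·2^k/2. Let 0 ≤ α < 1/2 with αn an integer. Fix any assignment a ∈ {0,1}^n and set T̃ = m·(1 − (1−α)^{2k})/(2^k − 1). For a formula φ, let S_{αn}(φ) be the set of assignments h ∈ H(a, α, n) with NumClausesUnSAT(φ, h) > T̃. Then for φ drawn from D_pa(m,n,k,a), Pr[|S_{αn}(φ)| > (1/2)·|H(a,α,n)|] ≤ 2·e^{−(1−α)^{2k}·ln(2)·n/16}. -/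
open scoped Classical
open Finset

/-- An assignment of `n` Boolean variables. -/
abbrev Assignment (n : ℕ) := Fin n → Bool

/-- A clause: an ordered `k`-tuple of literals, each a variable index together with a sign. -/
abbrev Clause (n k : ℕ) := Fin k → Fin n × Bool

/-- A formula: an ordered `m`-tuple of clauses. -/
abbrev Formula (n k m : ℕ) := Fin m → Clause n k

/-- An assignment satisfies a clause if it satisfies at least one literal of the clause. -/
def SatClause {n k : ℕ} (v : Assignment n) (c : Clause n k) : Prop :=
  ∃ i, v (c i).1 = (c i).2

/-- An assignment satisfies a formula if it satisfies every clause. -/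
def SatFormula {n k m : ℕ} (v : Assignment n) (φ : Formula n k m) : Prop :=
  ∀ j, SatClause v (φ j)

/-- The number of clauses of `φ` satisfied by `v`. -/
noncomputable def numSat {n k m : ℕ} (φ : Formula n k m) (v : Assignment n) : ℕ :=
  (Finset.univ.filter fun j => SatClause v (φ j)).card

/-- The number of clauses of `φ` left unsatisfied by `v`. -/
noncomputable def numUnsat {n k m : ℕ} (φ : Formula n k m) (v : Assignment n) : ℕ :=
  (Finset.univ.filter fun j => ¬ SatClause v (φ j)).card


/-! ### Binomial expectations, defined recursively -/

/-- Expectation of `f` under the binomial law with parameters `m`, `p`. -/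
noncomputable def BinE (p : ℝ) : ℕ → (ℕ → ℝ) → ℝ
  | 0, f => f 0
  | m + 1, f => (1 - p) * BinE p m f + p * BinE p m (fun x => f (x + 1))

lemma BinE_mono {p : ℝ} (h0 : 0 ≤ p) (h1 : p ≤ 1) (m : ℕ) :
    ∀ f g : ℕ → ℝ, (∀ x, f x ≤ g x) → BinE p m f ≤ BinE p m g := by
  induction m with
  | zero => intro f g h; exact h 0
  | succ m ih =>
    intro f g h
    simp only [BinE]
    have a := ih f g h
    have b := ih (fun x => f (x + 1)) (fun x => g (x + 1)) (fun x => h _)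
    have : 0 ≤ 1 - p := by linarith
    gcongr

lemma BinE_const (p c : ℝ) (m : ℕ) : BinE p m (fun _ => c) = c := by
  induction m with
  | zero => rfl
  | succ m ih => simp only [BinE, ih]; ring

lemma BinE_affine (p a b : ℝ) (m : ℕ) : ∀ f : ℕ → ℝ,
    BinE p m (fun x => a + b * f x) = a + b * BinE p m f := by
  induction m with
  | zero => intro f; rfl
  | succ m ih =>
    intro f
    simp only [BinE, ih]
    ring

lemma BinE_nonneg {p : ℝ} (h0 : 0 ≤ p) (h1 : p ≤ 1) (m : ℕ) (f : ℕ → ℝ) (hf : ∀ x, 0 ≤ f x) :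
    0 ≤ BinE p m f := by
  have := BinE_mono h0 h1 m (fun _ => 0) f hf
  rwa [BinE_const] at this

lemma BinE_pow (p u : ℝ) (m : ℕ) : ∀ c : ℝ, BinE p m (fun x => c * u ^ x) = c * (1 - p + p * u) ^ m := by
  induction m with
  | zero => intro c; simp [BinE]
  | succ m ih =>
    intro c
    have h : (fun x : ℕ => c * u ^ (x + 1)) = fun x => (c * u) * u ^ x := by
      funext x; ring
    simp only [BinE, h, ih]
    ring

lemma BinE_sq (p : ℝ) (m : ℕ) : ∀ a : ℝ,
    BinE p m (fun x => ((x : ℝ) - a) ^ 2) = m * p * (1 - p) + (m * p - a) ^ 2 := by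
  induction m with
  | zero => intro a; simp [BinE]
  | succ m ih =>
    intro a
    have h : (fun x : ℕ => (((x + 1 : ℕ) : ℝ) - a) ^ 2) = fun x : ℕ => ((x : ℝ) - (a - 1)) ^ 2 := by
      funext x; push_cast; ring
    simp only [BinE, h, ih]
    push_cast
    ring

lemma BinE_id (p : ℝ) (m : ℕ) : ∀ a : ℝ, BinE p m (fun x => (x : ℝ) + a) = m * p + a := by
  induction m with
  | zero => intro a; simp [BinE]
  | succ m ih =>
    intro a
    have h : (fun x : ℕ => ((x + 1 : ℕ) : ℝ) + a) = fun x : ℕ => (x : ℝ) + (a + 1) := by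
      funext x; push_cast; ring
    simp only [BinE, h, ih]
    push_cast
    ring

lemma BinE_hinge1 (p : ℝ) (m : ℕ) :
    BinE p m (fun x => ((x - 1 : ℕ) : ℝ)) = m * p - 1 + (1 - p) ^ m := by
  induction m with
  | zero => simp [BinE]
  | succ m ih =>
    have h := BinE_id p m 0
    simp only [add_zero] at h
    simp only [BinE, ih, Nat.add_sub_cancel, h]
    push_cast
    ring

lemma BinE_hinge2 (p : ℝ) (hp : p < 1) (m : ℕ) :
    BinE p m (fun x => ((x - 2 : ℕ) : ℝ))
      = m * p - 2 + 2 * (1 - p) ^ m + m * p * (1 - p) ^ m / (1 - p) := by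
  have hq : 1 - p ≠ 0 := by linarith
  induction m with
  | zero => simp [BinE]
  | succ m ih =>
    have h := BinE_hinge1 p m
    have e : (fun x : ℕ => ((x + 1 - 2 : ℕ) : ℝ)) = fun x => ((x - 1 : ℕ) : ℝ) := by
      funext x; congr 1
    simp only [BinE, ih, e, h]
    push_cast
    field_simp
    ring

/-! ### Negative association of counts of disjoint events -/

lemma sum_prod_disjoint {γ ι : Type*} (C : Finset γ) (A : ι → γ → Prop) [∀ i, DecidablePred (A i)] (p : ℝ)
    (hp : 0 ≤ p)
    (hdis : ∀ c ∈ C, ∀ i j, A i c → A j c → i = j)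
    (hcard : ∀ i, ((C.filter (A i)).card : ℝ) ≤ p * C.card)
    (x y : ι → ℝ) (hx : ∀ i, 0 ≤ x i) (hy : ∀ i, 0 ≤ y i) (s : Finset ι) :
    ∑ c ∈ C, ∏ i ∈ s, (x i + if A i c then y i else 0) ≤ C.card * ∏ i ∈ s, (x i + p * y i) := by
  induction s using Finset.induction_on with
  | empty => simp
  | insert i s hi ih =>
    simp only [Finset.prod_insert hi]
    have h1 : ∀ c ∈ C, (x i + if A i c then y i else 0) * ∏ j ∈ s, (x j + if A j c then y j else 0)
        = x i * ∏ j ∈ s, (x j + if A j c then y j else 0)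
          + if A i c then y i * ∏ j ∈ s, x j else 0 := by
      intro c hc
      by_cases h : A i c
      · have : ∏ j ∈ s, (x j + if A j c then y j else 0) = ∏ j ∈ s, x j := by
          apply Finset.prod_congr rfl
          intro j hj
          have : ¬ A j c := by
            intro h'
            have := hdis c hc i j h h'
            subst this
            exact hi hj
          simp [this]
        simp only [h, if_true, this]
        ring
      · simp [h]
    rw [Finset.sum_congr rfl h1, Finset.sum_add_distrib, ← Finset.mul_sum, ← Finset.sum_filter,
      Finset.sum_const, nsmul_eq_mul]
    have h2 : ∏ j ∈ s, x j ≤ ∏ j ∈ s, (x j + p * y j) :=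
      Finset.prod_le_prod (fun j _ => hx j) (fun j _ => by
        have := mul_nonneg hp (hy j); linarith)
    have h3 : 0 ≤ ∏ j ∈ s, x j := Finset.prod_nonneg (fun j _ => hx j)
    have h4 : ((C.filter (A i)).card : ℝ) * (y i * ∏ j ∈ s, x j)
        ≤ (p * C.card) * (y i * ∏ j ∈ s, (x j + p * y j)) := by
      have := hy i
      have := hcard i
      gcongr
    have h5 := mul_le_mul_of_nonneg_left ih (hx i)
    nlinarith [h4, h5]

lemma neg_assoc {γ ι : Type*} [Fintype ι] (C : Finset γ) (A : ι → γ → Prop)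
    [∀ i, DecidablePred (A i)] (p : ℝ) (h0 : 0 ≤ p) (h1 : p ≤ 1)
    (hdis : ∀ c ∈ C, ∀ i j, A i c → A j c → i = j)
    (hcard : ∀ i, ((C.filter (A i)).card : ℝ) ≤ p * C.card) (m : ℕ) :
    ∀ f : ι → ℕ → ℝ, (∀ i x, 0 ≤ f i x) → (∀ i x, f i x ≤ f i (x + 1)) →
    ∑ φ ∈ Fintype.piFinset (fun _ : Fin m => C),
      ∏ i, f i ((Finset.univ.filter fun j => A i (φ j)).card)
      ≤ (C.card : ℝ) ^ m * ∏ i, BinE p m (f i) := by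
  induction m with
  | zero =>
    intro f hf hm
    simp [BinE]
  | succ m ih =>
    intro f hf hm
    have key : ∑ φ ∈ Fintype.piFinset (fun _ : Fin (m+1) => C),
        ∏ i, f i ((Finset.univ.filter fun j => A i (φ j)).card)
        = ∑ c ∈ C, ∑ φ ∈ Fintype.piFinset (fun _ : Fin m => C),
          ∏ i, (fun x => f i (x + if A i c then 1 else 0))
            ((Finset.univ.filter fun j => A i (φ j)).card) := by
      rw [← Finset.sum_product']
      symm
      apply Finset.sum_bij' (fun q _ => (Fin.cons q.1 q.2 : Fin (m+1) → γ))
        (fun φ _ => (φ 0, Fin.tail φ))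
      · rintro ⟨c, φ⟩ h
        simp only [Finset.mem_product, Fintype.mem_piFinset] at h ⊢
        intro j
        refine Fin.cases ?_ ?_ j
        · exact h.1
        · exact h.2
      · intro φ h
        simp only [Finset.mem_product, Fintype.mem_piFinset] at h ⊢
        exact ⟨h 0, fun j => h _⟩
      · rintro ⟨c, φ⟩ h
        simp
      · intro φ h
        simp
      · rintro ⟨c, φ⟩ h
        apply Finset.prod_congr rfl
        intro i _
        congr 1
        rw [Fin.univ_succ, Finset.filter_cons]
        by_cases hA : A i c
        · simp [hA, Finset.filter_map, Function.comp_def]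
        · simp [hA, Finset.filter_map, Function.comp_def]
    rw [key]
    have step : ∀ c ∈ C, ∑ φ ∈ Fintype.piFinset (fun _ : Fin m => C),
          ∏ i, (fun x => f i (x + if A i c then 1 else 0))
            ((Finset.univ.filter fun j => A i (φ j)).card)
        ≤ (C.card : ℝ) ^ m * ∏ i, (BinE p m (f i) +
            if A i c then (BinE p m (fun x => f i (x+1)) - BinE p m (f i)) else 0) := by
      intro c hc
      refine (ih (fun i x => f i (x + if A i c then 1 else 0)) (fun i x => hf _ _)
        (fun i x => ?_)).trans (le_of_eq ?_)
      · have := hm i (x + if A i c then 1 else 0)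
        rwa [add_right_comm] at this
      · congr 1
        apply Finset.prod_congr rfl
        intro i _
        by_cases hA : A i c <;> simp [hA]
    refine (Finset.sum_le_sum step).trans ?_
    rw [← Finset.mul_sum]
    have := sum_prod_disjoint C A p h0 hdis hcard (fun i => BinE p m (f i))
      (fun i => BinE p m (fun x => f i (x+1)) - BinE p m (f i))
      (fun i => BinE_nonneg h0 h1 m _ (hf i))
      (fun i => by
        have := BinE_mono h0 h1 m (f i) (fun x => f i (x+1)) (hm i)
        linarith) Finset.univ
    calc _ ≤ (C.card : ℝ) ^ m * (C.card * ∏ i, (BinE p m (f i) +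
          p * (BinE p m (fun x => f i (x+1)) - BinE p m (f i)))) := by gcongr
      _ = _ := by
        rw [pow_succ, mul_assoc]
        congr 2
        apply Finset.prod_congr rfl
        intro i _
        simp only [BinE]
        ring

/-! ### Symmetrization over permutations of the variables -/

/-- Flip the assignment `a` on the set `D`. -/
def flipOn {n : ℕ} (a : Assignment n) (D : Finset (Fin n)) : Assignment n :=
  fun v => if v ∈ D then !a v else a v

lemma hammingDist_flipOn {n : ℕ} (a : Assignment n) (D : Finset (Fin n)) :
    hammingDist a (flipOn a D) = D.card := by
  unfold hammingDist flipOn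
  congr 1
  ext v
  by_cases h : v ∈ D <;> simp [h]

lemma flipOn_diff {n : ℕ} (a h : Assignment n) :
    flipOn a (univ.filter fun v => a v ≠ h v) = h := by
  funext v
  unfold flipOn
  cases h1 : a v <;> cases h2 : h v <;> simp [h1, h2]

lemma diff_flipOn {n : ℕ} (a : Assignment n) (D : Finset (Fin n)) :
    (univ.filter fun v => a v ≠ flipOn a D v) = D := by
  ext v
  unfold flipOn
  by_cases h : v ∈ D <;> simp [h]

lemma card_ball_filter {n : ℕ} (a : Assignment n) (t : ℕ) (P : Assignment n → Prop) :
    ((univ.filter fun h => hammingDist a h ≤ t).filter P).card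
      = ((univ.filter fun D : Finset (Fin n) => D.card ≤ t).filter fun D => P (flipOn a D)).card := by
  apply Finset.card_nbij' (fun h => univ.filter fun v => a v ≠ h v) (fun D => flipOn a D)
  · intro h hh
    simp only [coe_filter, mem_filter, mem_univ, true_and, Set.mem_setOf_eq] at hh ⊢
    rw [flipOn_diff]
    exact hh
  · intro D hD
    simp only [coe_filter, mem_filter, mem_univ, true_and, Set.mem_setOf_eq] at hD ⊢
    rw [hammingDist_flipOn]
    exact hD
  · intro h _
    exact flipOn_diff a h
  · intro D _
    exact diff_flipOn a D

lemma exists_disjoint_perms (n t L : ℕ) (hL : L * t ≤ n) (D : Finset (Fin n)) (hD : D.card ≤ t) :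
    ∃ τ : Fin L → Equiv.Perm (Fin n),
      ∀ i j, i ≠ j → Disjoint (D.map (τ i).toEmbedding) (D.map (τ j).toEmbedding) := by
  have hlt : ∀ (i : Fin L) (x : Fin D.card), i.val * t + x.val < n := by
    intro i x
    have h1 : (i.val + 1) * t ≤ L * t := Nat.mul_le_mul_right _ i.isLt
    have h2 := x.isLt
    nlinarith
  let g : Fin L → Fin D.card ↪ Fin n := fun i =>
    ⟨fun x => ⟨i.val * t + x.val, hlt i x⟩, by
      intro x y hxy
      simp only [Fin.mk.injEq] at hxy
      ext
      omega⟩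
  let D' : Fin L → Finset (Fin n) := fun i => univ.map (g i)
  have hc : ∀ i, (D' i).card = D.card := by intro i; simp [D']
  have hdis : ∀ i j, i ≠ j → Disjoint (D' i) (D' j) := by
    intro i j hij
    rw [Finset.disjoint_left]
    intro v hv hv'
    simp only [D', mem_map, mem_univ, true_and] at hv hv'
    obtain ⟨x, rfl⟩ := hv
    obtain ⟨y, hy⟩ := hv'
    have hy' : j.val * t + y.val = i.val * t + x.val := by
      have h3 := congrArg Fin.val hy
      exact h3
    have hx := x.isLt
    have hyy := y.isLt
    apply hij
    ext
    rcases lt_trichotomy i.val j.val with h | h | h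
    · have : (i.val + 1) * t ≤ j.val * t := Nat.mul_le_mul_right _ h
      nlinarith
    · exact h
    · have : (j.val + 1) * t ≤ i.val * t := Nat.mul_le_mul_right _ h
      nlinarith
  have hτ : ∀ i, ∃ τ : Equiv.Perm (Fin n), D.map τ.toEmbedding = D' i := by
    intro i
    have e : {x // x ∈ D} ≃ {x // x ∈ D' i} := Finset.equivOfCardEq (hc i).symm
    refine ⟨e.extendSubtype, ?_⟩
    apply Finset.eq_of_subset_of_card_le
    · intro v hv
      simp only [mem_map] at hv
      obtain ⟨x, hx, rfl⟩ := hv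
      exact e.extendSubtype_mem x hx
    · simp [hc i]
  choose τ hτ using hτ
  refine ⟨τ, fun i j hij => ?_⟩
  rw [hτ, hτ]
  exact hdis i j hij

lemma sum_perm_ball {n : ℕ} (t : ℕ) (σ : Equiv.Perm (Fin n)) (b : Finset (Fin n) → ℝ) :
    ∑ D ∈ univ.filter (fun D : Finset (Fin n) => D.card ≤ t), b (D.map σ.toEmbedding)
      = ∑ D ∈ univ.filter (fun D : Finset (Fin n) => D.card ≤ t), b D := by
  apply Finset.sum_nbij' (fun D => D.map σ.toEmbedding) (fun D => D.map σ.symm.toEmbedding)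
  · intro D hD; simpa using hD
  · intro D hD; simpa using hD
  · intro D _; ext v; simp
  · intro D _; ext v; simp
  · intro D _; rfl

lemma symmetrize {n : ℕ} (t L : ℕ) (τ : Finset (Fin n) → Fin L → Equiv.Perm (Fin n))
    (b : Finset (Fin n) → ℝ) :
    ∑ D ∈ univ.filter (fun D : Finset (Fin n) => D.card ≤ t), ∑ σ : Equiv.Perm (Fin n),
        ∑ i : Fin L, b ((D.map (τ D i).toEmbedding).map σ.toEmbedding)
      = (L : ℝ) * (Fintype.card (Equiv.Perm (Fin n)) : ℝ) *
        ∑ D ∈ univ.filter (fun D : Finset (Fin n) => D.card ≤ t), b D := by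
  have h1 : ∀ D : Finset (Fin n), ∑ σ : Equiv.Perm (Fin n),
        ∑ i : Fin L, b ((D.map (τ D i).toEmbedding).map σ.toEmbedding)
      = (L : ℝ) * ∑ σ : Equiv.Perm (Fin n), b (D.map σ.toEmbedding) := by
    intro D
    rw [Finset.sum_comm]
    have : ∀ i ∈ (univ : Finset (Fin L)), ∑ σ : Equiv.Perm (Fin n),
        b ((D.map (τ D i).toEmbedding).map σ.toEmbedding)
        = ∑ σ : Equiv.Perm (Fin n), b (D.map σ.toEmbedding) := by
      intro i _
      apply Fintype.sum_equiv (Equiv.mulRight (τ D i))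
      intro σ
      congr 1
      rw [Finset.map_map]
      rfl
    rw [Finset.sum_congr rfl this]
    simp
  simp only [h1]
  rw [← Finset.mul_sum, Finset.sum_comm, mul_assoc]
  congr 1
  rw [Finset.sum_congr rfl (fun σ _ => sum_perm_ball t σ b)]
  simp

/-! ### Clause counting -/

lemma not_sat_card {n k : ℕ} (v : Assignment n) :
    (univ.filter fun c : Clause n k => ¬ SatClause v c).card = n ^ k := by
  have : (univ.filter fun c : Clause n k => ¬ SatClause v c)
      = Fintype.piFinset (fun _ : Fin k => univ.filter fun q : Fin n × Bool => v q.1 ≠ q.2) := by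
    ext c
    simp [SatClause]
  rw [this, Fintype.card_piFinset]
  simp only [prod_const, card_univ, Fintype.card_fin]
  congr 1
  have h : (univ.filter fun q : Fin n × Bool => v q.1 ≠ q.2)
      = univ.image (fun x : Fin n => (x, !v x)) := by
    ext ⟨x, b⟩
    simp only [mem_filter, mem_univ, true_and, mem_image, Prod.mk.injEq, exists_eq_left]
    cases v x <;> cases b <;> simp
  rw [h, Finset.card_image_of_injective _ (fun x y h => congrArg Prod.fst h)]
  simp

lemma not_sat_both_card {n k : ℕ} (a : Assignment n) (D : Finset (Fin n)) :
    (univ.filter fun c : Clause n k => ¬ SatClause a c ∧ ¬ SatClause (flipOn a D) c).card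
      = (n - D.card) ^ k := by
  have : (univ.filter fun c : Clause n k => ¬ SatClause a c ∧ ¬ SatClause (flipOn a D) c)
      = Fintype.piFinset (fun _ : Fin k => Dᶜ.image
          (fun x : Fin n => (x, !a x))) := by
    ext c
    simp only [SatClause, mem_filter, mem_univ, true_and, Fintype.mem_piFinset, mem_image,
      not_exists, mem_compl, ← forall_and]
    apply forall_congr'
    intro i
    rcases c i with ⟨x, b⟩
    simp only [flipOn, Prod.mk.injEq]
    constructor
    · rintro ⟨h1, h2⟩
      refine ⟨x, ?_, rfl, ?_⟩
      · intro hx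
        simp only [hx, if_true] at h2
        revert h1 h2
        cases a x <;> cases b <;> simp
      · revert h1
        cases a x <;> cases b <;> simp
    · rintro ⟨y, hy, rfl, rfl⟩
      simp [hy]
  rw [this, Fintype.card_piFinset,
    Finset.card_image_of_injective _ (fun x y h => congrArg Prod.fst h)]
  simp [card_compl]

lemma sat_card {n k : ℕ} (a : Assignment n) :
    (univ.filter fun c : Clause n k => SatClause a c).card + n ^ k = (2 * n) ^ k := by
  rw [← not_sat_card (k := k) a, Finset.card_filter_add_card_filter_not]
  simp [mul_comm]

lemma sat_not_sat_card {n k : ℕ} (a : Assignment n) (D : Finset (Fin n)) :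
    ((univ.filter fun c : Clause n k => SatClause a c).filter
      fun c => ¬ SatClause (flipOn a D) c).card + (n - D.card) ^ k = n ^ k := by
  rw [← not_sat_both_card a D, ← not_sat_card (k := k) (flipOn a D)]
  rw [← Finset.card_union_of_disjoint]
  · congr 1
    ext c
    simp only [mem_union, mem_filter, mem_univ, true_and]
    tauto
  · rw [Finset.disjoint_left]
    intro c
    simp only [mem_filter, mem_univ, true_and]
    tauto

/-! ### The exponential-moment bound over disjoint blocks -/

lemma count_bound {n k m : ℕ} (a : Assignment n) (T : ℝ) (t L : ℕ) (hL : L * t ≤ n)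
    (p : ℝ) (h0 : 0 ≤ p) (h1 : p ≤ 1)
    (hcard : ∀ D : Finset (Fin n), D.card ≤ t →
      (((univ.filter fun c : Clause n k => SatClause a c).filter
        fun c => ¬ SatClause (flipOn a D) c).card : ℝ)
        ≤ p * (univ.filter fun c : Clause n k => SatClause a c).card)
    (w : ℝ) (hw : 1 ≤ w) :
    (((univ.filter fun φ : Formula n k m => SatFormula a φ).filter fun φ =>
      (((univ.filter fun h => hammingDist a h ≤ t).filter fun h => T < (numUnsat φ h : ℝ)).card : ℝ)
        > ((univ.filter fun h : Assignment n => hammingDist a h ≤ t).card : ℝ) / 2).card : ℝ)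
      * Real.exp (Real.log w * L / 2)
    ≤ ((univ.filter fun φ : Formula n k m => SatFormula a φ).card : ℝ)
      * (1 + (w - 1) * BinE p m (fun x => if T < (x : ℝ) then 1 else 0)) ^ L := by
  set C := univ.filter fun c : Clause n k => SatClause a c with hC
  set P := univ.filter fun φ : Formula n k m => SatFormula a φ with hP
  set Ds := univ.filter (fun D : Finset (Fin n) => D.card ≤ t) with hDs
  have hPC : P = Fintype.piFinset (fun _ : Fin m => C) := by
    ext φ
    rw [hP, mem_filter, Fintype.mem_piFinset]
    simp only [hC, mem_filter, mem_univ, true_and]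
    rfl
  have hPcard : (P.card : ℝ) = (C.card : ℝ) ^ m := by
    rw [hPC, Fintype.card_piFinset]; simp
  have hH : (univ.filter fun h : Assignment n => hammingDist a h ≤ t).card = Ds.card := by
    have := card_ball_filter a t (fun _ => True)
    simpa using this
  have hDpos : 0 < Ds.card := by
    apply Finset.card_pos.mpr
    exact ⟨∅, by simp [hDs]⟩
  have hτ : ∀ D : Finset (Fin n), ∃ τ : Fin L → Equiv.Perm (Fin n), D.card ≤ t →
      ∀ i j, i ≠ j → Disjoint (D.map (τ i).toEmbedding) (D.map (τ j).toEmbedding) := by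
    intro D
    by_cases hD : D.card ≤ t
    · obtain ⟨τ, h⟩ := exists_disjoint_perms n t L hL D hD
      exact ⟨τ, fun _ => h⟩
    · exact ⟨fun _ => 1, fun h => absurd h hD⟩
  choose τ hτ using hτ
  have hslog : 0 ≤ Real.log w := Real.log_nonneg hw
  let E : Finset (Fin n) → Equiv.Perm (Fin n) → Fin L → Finset (Fin n) :=
    fun D σ i => (D.map (τ D i).toEmbedding).map σ.toEmbedding
  let f : ℕ → ℝ := fun x => 1 + (w - 1) * (if T < (x : ℝ) then 1 else 0)
  have hf : ∀ x : ℕ, f x = Real.exp (Real.log w * (if T < (x : ℝ) then 1 else 0)) := by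
    intro x
    by_cases h : T < (x : ℝ)
    · simp [f, h, Real.exp_log (by linarith : 0 < w)]
    · simp [f, h]
  let Z : ℝ := (Ds.card : ℝ) * (Fintype.card (Equiv.Perm (Fin n)) : ℝ)
  have hZ : 0 < Z := by
    have : 0 < Fintype.card (Equiv.Perm (Fin n)) := Fintype.card_pos
    simp only [Z]
    positivity
  -- per formula
  have hper : ∀ φ ∈ P.filter (fun φ =>
      (((univ.filter fun h => hammingDist a h ≤ t).filter fun h => T < (numUnsat φ h : ℝ)).card : ℝ)
        > ((univ.filter fun h : Assignment n => hammingDist a h ≤ t).card : ℝ) / 2),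
      Real.exp (Real.log w * L / 2) ≤
        ∑ q ∈ Ds ×ˢ (univ : Finset (Equiv.Perm (Fin n))), Z⁻¹ *
          ∏ i, f (numUnsat φ (flipOn a (E q.1 q.2 i))) := by
    intro φ hφ
    rw [mem_filter] at hφ
    have hb := hφ.2
    rw [hH, card_ball_filter a t (fun h => T < (numUnsat φ h : ℝ))] at hb
    let b : Finset (Fin n) → ℝ := fun D => if T < (numUnsat φ (flipOn a D) : ℝ) then 1 else 0
    have hsum : ∑ D ∈ Ds, b D = ((Ds.filter fun D => T < (numUnsat φ (flipOn a D) : ℝ)).card : ℝ) := by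
      simp [b, Finset.sum_ite]
    have hsym := symmetrize t L τ b
    have hprod : ∀ q : Finset (Fin n) × Equiv.Perm (Fin n),
        ∏ i, f (numUnsat φ (flipOn a (E q.1 q.2 i)))
        = Real.exp (Real.log w * ∑ i, b (E q.1 q.2 i)) := by
      intro q
      rw [Finset.mul_sum, Real.exp_sum]
      apply Finset.prod_congr rfl
      intro i _
      rw [hf]
    have jens := convexOn_exp.map_sum_le (t := Ds ×ˢ (univ : Finset (Equiv.Perm (Fin n))))
      (w := fun _ => Z⁻¹) (p := fun q => Real.log w * ∑ i, b (E q.1 q.2 i))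
      (fun _ _ => by positivity)
      (by
        rw [Finset.sum_const, nsmul_eq_mul, Finset.card_product, Finset.card_univ]
        push_cast
        exact mul_inv_cancel₀ hZ.ne')
      (fun _ _ => Set.mem_univ _)
    simp only [smul_eq_mul] at jens
    simp only [hprod]
    refine le_trans ?_ jens
    apply Real.exp_le_exp.mpr
    rw [← Finset.mul_sum, ← Finset.mul_sum, Finset.sum_product]
    have e : ∑ x ∈ Ds, ∑ y : Equiv.Perm (Fin n), ∑ i, b (E x y i)
        = (L : ℝ) * (Fintype.card (Equiv.Perm (Fin n)) : ℝ) * ∑ D ∈ Ds, b D := hsym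
    rw [e, hsum]
    have hpos : 0 < (Fintype.card (Equiv.Perm (Fin n)) : ℝ) := by
      exact_mod_cast Fintype.card_pos
    have hDp : 0 < (Ds.card : ℝ) := by exact_mod_cast hDpos
    have : Z⁻¹ * (Real.log w * ((L : ℝ) * (Fintype.card (Equiv.Perm (Fin n)) : ℝ) *
        ((Ds.filter fun D => T < (numUnsat φ (flipOn a D) : ℝ)).card : ℝ)))
        = Real.log w * L * (((Ds.filter fun D => T < (numUnsat φ (flipOn a D) : ℝ)).card : ℝ) / Ds.card) := by
      simp only [Z]
      field_simp
    rw [this, mul_div_assoc]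
    have h2 : (1 : ℝ) / 2 ≤ ((Ds.filter fun D => T < (numUnsat φ (flipOn a D) : ℝ)).card : ℝ) / Ds.card := by
      rw [le_div_iff₀ hDp]
      linarith
    calc Real.log w * (L / 2) = Real.log w * L * (1 / 2) := by ring
      _ ≤ _ := by gcongr
  have hfm : ∀ x : ℕ, f x ≤ f (x + 1) := by
    intro x
    have : (if T < (x : ℝ) then (1 : ℝ) else 0) ≤ if T < ((x + 1 : ℕ) : ℝ) then 1 else 0 := by
      by_cases h : T < (x : ℝ)
      · have h' : T < ((x + 1 : ℕ) : ℝ) := by push_cast; linarith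
        simp only [h, h', if_true]; exact le_refl _
      · simp only [h, if_false]
        split_ifs <;> norm_num
    simp only [f]
    have hw' : 0 ≤ w - 1 := by linarith
    have := mul_le_mul_of_nonneg_left this hw'
    linarith
  have hf0 : ∀ x : ℕ, 0 ≤ f x := fun x => by rw [hf]; positivity
  have hna : ∀ q ∈ Ds ×ˢ (univ : Finset (Equiv.Perm (Fin n))),
      ∑ φ ∈ P, ∏ i, f (numUnsat φ (flipOn a (E q.1 q.2 i)))
        ≤ (P.card : ℝ) * (1 + (w - 1) * BinE p m (fun x => if T < (x : ℝ) then 1 else 0)) ^ L := by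
    rintro ⟨D, σ⟩ hq
    have hD : D.card ≤ t := by
      simpa [hDs] using hq
    have := neg_assoc C (fun (i : Fin L) c => ¬ SatClause (flipOn a (E D σ i)) c) p h0 h1
      (by
        intro c hc i j hi hj
        by_contra hij
        have hd : Disjoint (E D σ i) (E D σ j) := by
          simp only [E, Finset.disjoint_map]
          exact hτ D hD i j hij
        simp only [hC, mem_filter, mem_univ, true_and] at hc
        obtain ⟨l, hl⟩ := hc
        have mem : ∀ F : Finset (Fin n), ¬ SatClause (flipOn a F) c → (c l).1 ∈ F := by
          intro F hF
          by_contra hm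
          apply hF
          refine ⟨l, ?_⟩
          simp [flipOn, hm, hl]
        exact Finset.disjoint_left.mp hd (mem _ hi) (mem _ hj))
      (by
        intro i
        apply hcard
        simpa [E] using hD) m (fun _ => f) (fun _ => hf0) (fun _ => hfm)
    rw [← hPC, ← hPcard, Finset.prod_const, Finset.card_univ, Fintype.card_fin, BinE_affine] at this
    exact this
  set Q := P.filter (fun φ =>
      (((univ.filter fun h => hammingDist a h ≤ t).filter fun h => T < (numUnsat φ h : ℝ)).card : ℝ)
        > ((univ.filter fun h : Assignment n => hammingDist a h ≤ t).card : ℝ) / 2) with hQ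
  calc (Q.card : ℝ) * Real.exp (Real.log w * L / 2)
      = ∑ φ ∈ Q, Real.exp (Real.log w * L / 2) := by
        rw [Finset.sum_const, nsmul_eq_mul]
    _ ≤ ∑ φ ∈ Q, ∑ q ∈ Ds ×ˢ (univ : Finset (Equiv.Perm (Fin n))), Z⁻¹ *
          ∏ i, f (numUnsat φ (flipOn a (E q.1 q.2 i))) := Finset.sum_le_sum hper
    _ ≤ ∑ φ ∈ P, ∑ q ∈ Ds ×ˢ (univ : Finset (Equiv.Perm (Fin n))), Z⁻¹ *
          ∏ i, f (numUnsat φ (flipOn a (E q.1 q.2 i))) := by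
        apply Finset.sum_le_sum_of_subset_of_nonneg (Finset.filter_subset _ _)
        intro φ _ _
        apply Finset.sum_nonneg
        intro q _
        apply mul_nonneg (by positivity)
        exact Finset.prod_nonneg (fun i _ => hf0 _)
    _ = ∑ q ∈ Ds ×ˢ (univ : Finset (Equiv.Perm (Fin n))), Z⁻¹ * ∑ φ ∈ P,
          ∏ i, f (numUnsat φ (flipOn a (E q.1 q.2 i))) := by
        rw [Finset.sum_comm]
        apply Finset.sum_congr rfl
        intro q _
        rw [Finset.mul_sum]
    _ ≤ ∑ q ∈ Ds ×ˢ (univ : Finset (Equiv.Perm (Fin n))), Z⁻¹ *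
        ((P.card : ℝ) * (1 + (w - 1) * BinE p m (fun x => if T < (x : ℝ) then 1 else 0)) ^ L) := by
        apply Finset.sum_le_sum
        intro q hq
        exact mul_le_mul_of_nonneg_left (hna q hq) (by positivity)
    _ = _ := by
        rw [Finset.sum_const, nsmul_eq_mul, Finset.card_product, Finset.card_univ]
        push_cast
        rw [← mul_assoc]
        rw [mul_inv_cancel₀ hZ.ne', one_mul]

lemma count_bound_markov {n k m : ℕ} (a : Assignment n) (T : ℝ) (t : ℕ)
    (p : ℝ) (h0 : 0 ≤ p) (h1 : p ≤ 1)
    (hcard : ∀ D : Finset (Fin n), D.card ≤ t →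
      (((univ.filter fun c : Clause n k => SatClause a c).filter
        fun c => ¬ SatClause (flipOn a D) c).card : ℝ)
        ≤ p * (univ.filter fun c : Clause n k => SatClause a c).card) :
    (((univ.filter fun φ : Formula n k m => SatFormula a φ).filter fun φ =>
      (((univ.filter fun h => hammingDist a h ≤ t).filter fun h => T < (numUnsat φ h : ℝ)).card : ℝ)
        > ((univ.filter fun h : Assignment n => hammingDist a h ≤ t).card : ℝ) / 2).card : ℝ)
    ≤ ((univ.filter fun φ : Formula n k m => SatFormula a φ).card : ℝ)
      * (2 * BinE p m (fun x => if T < (x : ℝ) then 1 else 0)) := by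
  set C := univ.filter fun c : Clause n k => SatClause a c with hC
  set P := univ.filter fun φ : Formula n k m => SatFormula a φ with hP
  set Ds := univ.filter (fun D : Finset (Fin n) => D.card ≤ t) with hDs
  have hPC : P = Fintype.piFinset (fun _ : Fin m => C) := by
    ext φ
    rw [hP, mem_filter, Fintype.mem_piFinset]
    simp only [hC, mem_filter, mem_univ, true_and]
    rfl
  have hPcard : (P.card : ℝ) = (C.card : ℝ) ^ m := by
    rw [hPC, Fintype.card_piFinset]; simp
  have hH : (univ.filter fun h : Assignment n => hammingDist a h ≤ t).card = Ds.card := by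
    have := card_ball_filter a t (fun _ => True)
    simpa using this
  have hDpos : 0 < Ds.card := by
    apply Finset.card_pos.mpr
    exact ⟨∅, by simp [hDs]⟩
  have hDp : 0 < (Ds.card : ℝ) := by exact_mod_cast hDpos
  let f : ℕ → ℝ := fun x => if T < (x : ℝ) then 1 else 0
  have hf0 : ∀ x, 0 ≤ f x := fun x => by simp only [f]; split_ifs <;> norm_num
  have hfm : ∀ x : ℕ, f x ≤ f (x + 1) := by
    intro x
    simp only [f]
    by_cases h : T < (x : ℝ)
    · have h' : T < ((x + 1 : ℕ) : ℝ) := by push_cast; linarith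
      simp only [h, h', if_true]; exact le_refl _
    · simp only [h, if_false]
      split_ifs <;> norm_num
  have hna : ∀ D ∈ Ds, ∑ φ ∈ P, f (numUnsat φ (flipOn a D)) ≤ (P.card : ℝ) * BinE p m f := by
    intro D hq
    have hD : D.card ≤ t := by simpa [hDs] using hq
    have := neg_assoc C (fun (_ : Fin 1) c => ¬ SatClause (flipOn a D) c) p h0 h1
      (fun _ _ _ _ _ _ => Subsingleton.elim _ _)
      (fun _ => hcard D hD) m (fun _ => f) (fun _ => hf0) (fun _ => hfm)
    rw [← hPC, ← hPcard] at this
    simpa [numUnsat] using this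
  set Q := P.filter (fun φ =>
      (((univ.filter fun h => hammingDist a h ≤ t).filter fun h => T < (numUnsat φ h : ℝ)).card : ℝ)
        > ((univ.filter fun h : Assignment n => hammingDist a h ≤ t).card : ℝ) / 2) with hQ
  have hper : ∀ φ ∈ Q, (Ds.card : ℝ) / 2 ≤ ∑ D ∈ Ds, f (numUnsat φ (flipOn a D)) := by
    intro φ hφ
    rw [hQ, mem_filter] at hφ
    have hb := hφ.2
    rw [hH, card_ball_filter a t (fun h => T < (numUnsat φ h : ℝ))] at hb
    have hsum : ∑ D ∈ Ds, f (numUnsat φ (flipOn a D))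
        = ((Ds.filter fun D => T < (numUnsat φ (flipOn a D) : ℝ)).card : ℝ) := by
      simp [f, Finset.sum_ite]
    rw [hsum]
    exact le_of_lt hb
  have : (Q.card : ℝ) * ((Ds.card : ℝ) / 2) ≤ (Ds.card : ℝ) * ((P.card : ℝ) * BinE p m f) := by
    calc (Q.card : ℝ) * ((Ds.card : ℝ) / 2) = ∑ φ ∈ Q, (Ds.card : ℝ) / 2 := by
          rw [Finset.sum_const, nsmul_eq_mul]
      _ ≤ ∑ φ ∈ Q, ∑ D ∈ Ds, f (numUnsat φ (flipOn a D)) := Finset.sum_le_sum hper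
      _ ≤ ∑ φ ∈ P, ∑ D ∈ Ds, f (numUnsat φ (flipOn a D)) := by
          apply Finset.sum_le_sum_of_subset_of_nonneg (Finset.filter_subset _ _)
          intro φ _ _
          exact Finset.sum_nonneg (fun D _ => hf0 _)
      _ = ∑ D ∈ Ds, ∑ φ ∈ P, f (numUnsat φ (flipOn a D)) := Finset.sum_comm
      _ ≤ ∑ D ∈ Ds, (P.card : ℝ) * BinE p m f := Finset.sum_le_sum hna
      _ = _ := by rw [Finset.sum_const, nsmul_eq_mul]
  have h3 : (Ds.card : ℝ) * ((Q.card : ℝ) / 2) ≤ (Ds.card : ℝ) * ((P.card : ℝ) * BinE p m f) := by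
    linarith
  have h4 := le_of_mul_le_mul_left h3 hDp
  have h5 : (P.card : ℝ) * (2 * BinE p m f) = 2 * ((P.card : ℝ) * BinE p m f) := by ring
  change (Q.card : ℝ) ≤ (P.card : ℝ) * (2 * BinE p m f)
  rw [h5]
  linarith

/-! ### Tail bounds for the binomial distribution -/

lemma tail_cantelli (p : ℝ) (h0 : 0 ≤ p) (h1 : p ≤ 1) (m : ℕ) (T θ μ : ℝ) (hμ : μ = m * p)
    (hμ0 : 0 < μ) (hθ : μ < θ) (hT : ∀ x : ℕ, T < (x : ℝ) → θ ≤ (x : ℝ))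
    (w : ℝ) (hw0 : 0 ≤ w) (hw : w * μ ≤ (θ - μ) ^ 2) :
    BinE p m (fun x => if T < (x : ℝ) then 1 else 0) ≤ 1 / (1 + w) := by
  set s := θ - μ with hs
  have hs0 : 0 < s := by simp only [hs]; linarith
  set q := s + μ / s with hq
  have hq0 : 0 < q := by positivity
  have hle : BinE p m (fun x => if T < (x : ℝ) then 1 else 0)
      ≤ BinE p m (fun x => 0 + (1 / q ^ 2) * ((x : ℝ) - (θ - q)) ^ 2) := by
    apply BinE_mono h0 h1
    intro x
    by_cases h : T < (x : ℝ)
    · simp only [h, if_true, zero_add]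
      have := hT x h
      have h2 : q ≤ (x : ℝ) - (θ - q) := by linarith
      have h3 : q ^ 2 ≤ ((x : ℝ) - (θ - q)) ^ 2 := by gcongr
      rw [one_div, inv_mul_eq_div, le_div_iff₀ (by positivity)]
      linarith
    · simp only [h, if_false, zero_add]
      positivity
  refine hle.trans ?_
  rw [BinE_affine, BinE_sq, ← hμ]
  have e1 : μ - (θ - q) = μ / s := by simp only [hq, hs]; ring
  rw [e1, zero_add]
  have h3 : μ * (1 - p) + (μ / s) ^ 2 ≤ μ + (μ / s) ^ 2 := by nlinarith
  calc 1 / q ^ 2 * (μ * (1 - p) + (μ / s) ^ 2) ≤ 1 / q ^ 2 * (μ + (μ / s) ^ 2) := by gcongr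
    _ = μ / (s ^ 2 + μ) := by
      simp only [hq]
      field_simp
    _ ≤ 1 / (1 + w) := by
      rw [div_le_div_iff₀ (by positivity) (by positivity)]
      nlinarith

lemma tail_chernoff (p : ℝ) (h0 : 0 ≤ p) (h1 : p ≤ 1) (m : ℕ) (μ β : ℝ) (hμ : μ = m * p)
    (hβ0 : 0 ≤ β) :
    BinE p m (fun x => if μ * (1 + β) < (x : ℝ) then 1 else 0)
      ≤ Real.exp (-(β ^ 2 * μ / (2 + β))) := by
  have hμ0 : 0 ≤ μ := by rw [hμ]; positivity
  have hlog : 2 * β / (β + 2) ≤ Real.log (1 + β) := Real.le_log_one_add_of_nonneg hβ0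
  have hlog0 : 0 ≤ Real.log (1 + β) := Real.log_nonneg (by linarith)
  set T := μ * (1 + β) with hT
  have hle : BinE p m (fun x => if T < (x : ℝ) then 1 else 0)
      ≤ BinE p m (fun x => Real.exp (-(Real.log (1 + β) * T)) * (1 + β) ^ x) := by
    apply BinE_mono h0 h1
    intro x
    by_cases h : T < (x : ℝ)
    · simp only [h, if_true]
      have e : (1 + β) ^ x = Real.exp (Real.log (1 + β) * x) := by
        rw [← Real.rpow_natCast, Real.rpow_def_of_pos (by linarith)]
      rw [e, ← Real.exp_add]
      apply Real.one_le_exp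
      nlinarith
    · simp only [h, if_false]
      positivity
  refine hle.trans ?_
  rw [BinE_pow]
  have h2 : (1 - p + p * (1 + β)) ^ m ≤ Real.exp (μ * β) := by
    have : 1 - p + p * (1 + β) ≤ Real.exp (p * β) := by
      have := Real.add_one_le_exp (p * β)
      linarith
    calc (1 - p + p * (1 + β)) ^ m ≤ (Real.exp (p * β)) ^ m := by
          apply pow_le_pow_left₀ _ this
          nlinarith [mul_nonneg h0 hβ0]
      _ = Real.exp (μ * β) := by
          rw [← Real.exp_nat_mul, hμ]
          ring_nf
  calc _ ≤ Real.exp (-(Real.log (1 + β) * T)) * Real.exp (μ * β) := by gcongr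
    _ = Real.exp (-(Real.log (1 + β) * T) + μ * β) := by rw [Real.exp_add]
    _ ≤ _ := by
      apply Real.exp_le_exp.mpr
      have h3 : 2 * β / (β + 2) * T ≤ Real.log (1 + β) * T := by
        apply mul_le_mul_of_nonneg_right hlog
        positivity
      have h4 : 2 * β / (β + 2) * T = β ^ 2 * μ / (2 + β) + μ * β := by
        rw [hT]; field_simp; ring
      linarith

lemma tail_hinge (p : ℝ) (h0 : 0 ≤ p) (h1 : p < 1) (m : ℕ) (T μ : ℝ) (hμ : μ = m * p)
    (hT : 2 ≤ T) :
    BinE p m (fun x => if T < (x : ℝ) then 1 else 0)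
      ≤ μ - 2 + Real.exp (-μ) * (2 + μ / (1 - p)) := by
  have hle : BinE p m (fun x => if T < (x : ℝ) then 1 else 0)
      ≤ BinE p m (fun x => ((x - 2 : ℕ) : ℝ)) := by
    apply BinE_mono h0 h1.le
    intro x
    by_cases h : T < (x : ℝ)
    · simp only [h, if_true]
      have : (2 : ℝ) < x := by linarith
      have h2 : 2 < x := by exact_mod_cast this
      have h3 : 1 ≤ x - 2 := by omega
      exact_mod_cast h3
    · simp only [h, if_false]
      positivity
  refine hle.trans ?_
  rw [BinE_hinge2 p h1, ← hμ]
  have h2 : (1 - p) ^ m ≤ Real.exp (-μ) := by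
    calc (1 - p) ^ m ≤ (Real.exp (-p)) ^ m := by
          apply pow_le_pow_left₀ (by linarith)
          have := Real.add_one_le_exp (-p)
          linarith
      _ = Real.exp (-μ) := by
          rw [← Real.exp_nat_mul, hμ]
          ring_nf
  have hμ0 : 0 ≤ μ := by rw [hμ]; positivity
  have h3 : 0 ≤ 2 + μ / (1 - p) := by
    have : 0 < 1 - p := by linarith
    positivity
  have h4 := mul_le_mul_of_nonneg_right h2 h3
  have e : μ - 2 + 2 * (1 - p) ^ m + μ * (1 - p) ^ m / (1 - p)
      = μ - 2 + (1 - p) ^ m * (2 + μ / (1 - p)) := by ring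
  rw [e]
  linarith

/-- The exponent obtained from the block bound. -/
noncomputable def Gf (w : ℝ) : ℝ := Real.log ((1 + w) / 2) - Real.log w / 2

lemma Gf_ge (w : ℝ) (hw : 1 ≤ w) : (w - 1) ^ 2 / (w ^ 2 + 6 * w + 1) ≤ Gf w := by
  have hy : 0 ≤ (w - 1) ^ 2 / (4 * w) := by positivity
  have h := Real.le_log_one_add_of_nonneg hy
  have e1 : 1 + (w - 1) ^ 2 / (4 * w) = ((1 + w) / 2) ^ 2 / w := by field_simp; ring
  rw [e1, Real.log_div (by positivity) (by positivity), Real.log_pow] at h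
  have e2 : 2 * ((w - 1) ^ 2 / (4 * w)) / ((w - 1) ^ 2 / (4 * w) + 2)
      = 2 * ((w - 1) ^ 2 / (w ^ 2 + 6 * w + 1)) := by field_simp; ring
  rw [e2] at h
  push_cast at h
  unfold Gf
  linarith

lemma Gf_exp (R : ℝ) (hR : Real.log 2 ≤ R) : R / 2 - Real.log 2 ≤ Gf (Real.exp R - 1) := by
  have h2 : 2 ≤ Real.exp R := by
    calc (2 : ℝ) = Real.exp (Real.log 2) := (Real.exp_log (by norm_num)).symm
      _ ≤ _ := Real.exp_le_exp.mpr hR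
  unfold Gf
  have e : 1 + (Real.exp R - 1) = Real.exp R := by ring
  rw [e, Real.log_div (by positivity) (by norm_num), Real.log_exp]
  have h3 : Real.log (Real.exp R - 1) ≤ R := by
    rw [Real.log_le_iff_le_exp (by linarith)]
    linarith
  linarith

/-- Turning the block moment bound into an exponential bound. -/
lemma block_exp (Q P δ w : ℝ) (L : ℕ) (hP : 0 ≤ P) (hδ0 : 0 ≤ δ) (hδ : δ ≤ 1 / (1 + w)) (hw : 1 ≤ w)
    (h : Q * Real.exp (Real.log w * L / 2) ≤ P * (1 + (w - 1) * δ) ^ L) :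
    Q ≤ P * Real.exp (-(L * Gf w)) := by
  have h1 : 1 + (w - 1) * δ ≤ w / ((1 + w) / 2) := by
    have : (w - 1) * δ ≤ (w - 1) * (1 / (1 + w)) := by
      apply mul_le_mul_of_nonneg_left hδ; linarith
    have e : 1 + (w - 1) * (1 / (1 + w)) = w / ((1 + w) / 2) := by field_simp; ring
    linarith
  have h2 : (1 + (w - 1) * δ) ^ L ≤ Real.exp (L * (Real.log w - Real.log ((1 + w) / 2))) := by
    calc (1 + (w - 1) * δ) ^ L ≤ (w / ((1 + w) / 2)) ^ L := by
          apply pow_le_pow_left₀ _ h1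
          have : 0 ≤ (w - 1) * δ := mul_nonneg (by linarith) hδ0
          linarith
      _ = _ := by
          rw [Real.exp_nat_mul, ← Real.log_div (by positivity) (by positivity),
            Real.exp_log (by positivity)]
  have h3 : Q * Real.exp (Real.log w * L / 2) ≤ P * Real.exp (-(L * Gf w)) *
      Real.exp (Real.log w * L / 2) := by
    refine h.trans ?_
    rw [mul_assoc, ← Real.exp_add]
    have e : -(L * Gf w) + Real.log w * L / 2
        = L * (Real.log w - Real.log ((1 + w) / 2)) := by unfold Gf; ring
    rw [e]
    gcongr
  exact le_of_mul_le_mul_right h3 (Real.exp_pos _)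

/-! ### Elementary inequalities -/

lemma I1a (v β l : ℝ) (hl : 0.6931 < l) (hl' : l < 0.6932) (hv : 5.4 ≤ v) (hb : 2 / 3 ≤ β) (hb1 : β ≤ 1) :
    7 / 64 * v - l * (1 - β) ≤ 3 * β * (v / (2 + β) / 2 - l) := by
  have e : 3 * β * (v / (2 + β) / 2 - l) = (3 * β * v / 2 - 3 * β * l * (2 + β)) / (2 + β) := by
    field_simp
  rw [e, le_div_iff₀ (by linarith)]
  have h1 : 0 ≤ (v - 5.4) * (β - 2 / 3) := mul_nonneg (by linarith) (by linarith)
  have h2 : 0 ≤ (β - 2 / 3) * (1 - β) := mul_nonneg (by linarith) (by linarith)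
  have h3 : l * (3 * β * (2 + β) - (1 - β) * (2 + β)) ≤ 0.6932 * (3 * β * (2 + β) - (1 - β) * (2 + β)) := by
    apply mul_le_mul_of_nonneg_right hl'.le
    nlinarith
  nlinarith

lemma I1b (v β l : ℝ) (hl : 0.6931 < l) (hl' : l < 0.6932) (hv : 5.4 ≤ v) (hb : 2 / 3 ≤ β) (hb1 : β ≤ 1) :
    1 / 8 * v - l * (1 - β) ≤ 4 * β * (v / (2 + β) / 2 - l) := by
  have e : 4 * β * (v / (2 + β) / 2 - l) = (4 * β * v / 2 - 4 * β * l * (2 + β)) / (2 + β) := by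
    field_simp
  rw [e, le_div_iff₀ (by linarith)]
  have h1 : 0 ≤ (v - 5.4) * (β - 2 / 3) := mul_nonneg (by linarith) (by linarith)
  have h2 : 0 ≤ (β - 2 / 3) * (1 - β) := mul_nonneg (by linarith) (by linarith)
  have h3 : l * (4 * β * (2 + β) - (1 - β) * (2 + β)) ≤ 0.6932 * (4 * β * (2 + β) - (1 - β) * (2 + β)) := by
    apply mul_le_mul_of_nonneg_right hl'.le
    nlinarith
  nlinarith

lemma I2a (w β l : ℝ) (hl : 0.6931 < l) (hw : 2.3 ≤ w) (hw' : w ≤ 5.4) (hb : 0 ≤ β) (hb1 : β ≤ 1) :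
    (7 / 64 * w - l * (1 - β)) * (w ^ 2 + 6 * w + 1) ≤ 3 * β * (w - 1) ^ 2 := by
  have h1 : 0 ≤ 3 * (w - 1) ^ 2 - 7 / 64 * w * (w ^ 2 + 6 * w + 1) := by
    nlinarith [mul_nonneg (mul_nonneg (sub_nonneg.2 hw) (sub_nonneg.2 hw')) (by linarith : 0 ≤ w),
      mul_nonneg (sub_nonneg.2 hw) (sub_nonneg.2 hw')]
  have h2 : 0 ≤ (l - 7 / 64 * w) * (w ^ 2 + 6 * w + 1) := by
    apply mul_nonneg (by linarith); positivity
  nlinarith [mul_nonneg hb h1, mul_nonneg (sub_nonneg.2 hb1) h2]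

lemma I2b (w β l : ℝ) (hl : 0.6931 < l) (hw : 2.3 ≤ w) (hw' : w ≤ 5.4) (hb : 0 ≤ β) (hb1 : β ≤ 1) :
    (1 / 8 * w - l * (1 - β)) * (w ^ 2 + 6 * w + 1) ≤ 4 * β * (w - 1) ^ 2 := by
  have h1 : 0 ≤ 4 * (w - 1) ^ 2 - 1 / 8 * w * (w ^ 2 + 6 * w + 1) := by
    nlinarith [mul_nonneg (mul_nonneg (sub_nonneg.2 hw) (sub_nonneg.2 hw')) (by linarith : 0 ≤ w),
      mul_nonneg (sub_nonneg.2 hw) (sub_nonneg.2 hw')]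
  have h2 : 0 ≤ (l - 1 / 8 * w) * (w ^ 2 + 6 * w + 1) := by
    apply mul_nonneg (by linarith); positivity
  nlinarith [mul_nonneg hb h1, mul_nonneg (sub_nonneg.2 hb1) h2]

/-- monotonicity in `β` and in `l` -/
lemma Imono (c q w β β' l : ℝ) (hc : c ≤ 4) (hl : 0.6931 < l) (hw : 1 ≤ w) (hw' : w ≤ 2.3)
    (hb1 : β ≤ 1) (hbb : β ≤ β')
    (h : (q * w - 0.6931 * (1 - β')) * (w ^ 2 + 6 * w + 1) ≤ c * β' * (w - 1) ^ 2) :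
    (q * w - l * (1 - β)) * (w ^ 2 + 6 * w + 1) ≤ c * β * (w - 1) ^ 2 := by
  have hD : 0 ≤ w ^ 2 + 6 * w + 1 := by positivity
  have h1 : 0 ≤ 0.6931 * (w ^ 2 + 6 * w + 1) - c * (w - 1) ^ 2 := by
    have : c * (w - 1) ^ 2 ≤ 4 * (w - 1) ^ 2 := by gcongr
    nlinarith [mul_nonneg (sub_nonneg.2 hw) (sub_nonneg.2 hw')]
  have h2 := mul_nonneg (sub_nonneg.2 hbb) h1
  have h3 : 0 ≤ (l - 0.6931) * (1 - β) * (w ^ 2 + 6 * w + 1) :=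
    mul_nonneg (mul_nonneg (by linarith) (by linarith)) hD
  nlinarith

lemma I3a (w β l : ℝ) (hl : 0.6931 < l) (hw : 1 ≤ w) (hw' : w ≤ 2.3) (hb1 : β ≤ 0.8148) :
    (7 / 64 * w - l * (1 - β)) * (w ^ 2 + 6 * w + 1) ≤ 3 * β * (w - 1) ^ 2 := by
  apply Imono 3 (7 / 64) w β 0.8148 l (by norm_num) hl hw hw' (by linarith) hb1
  nlinarith [mul_nonneg (sq_nonneg (w - 1.6)) (sub_nonneg.2 hw'), sq_nonneg (w - 1.6)]

lemma I3b (w β l : ℝ) (hl : 0.6931 < l) (hw : 1 ≤ w) (hw' : w ≤ 2.3) (hb1 : β ≤ 0.8) :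
    (1 / 8 * w - l * (1 - β)) * (w ^ 2 + 6 * w + 1) ≤ 4 * β * (w - 1) ^ 2 := by
  apply Imono 4 (1 / 8) w β 0.8 l (by norm_num) hl hw hw' (by linarith) hb1
  nlinarith [mul_nonneg (sq_nonneg (w - 1.2)) (sub_nonneg.2 hw'), sq_nonneg (w - 1.2)]

lemma tang5 (w β : ℝ) (hb : 0 ≤ β) (h : 5 * β ^ 2 ≤ w * (1 + β)) :
    β ≤ 0.85 + (w - 1.9526) / 3.54 := by
  have : 0 < 1 + β := by linarith
  by_contra hc
  push Not at hc
  have : w ≤ 1.9526 + 3.54 * (β - 0.85) := by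
    have h2 : (w - 1.9526) / 3.54 < β - 0.85 := by linarith
    rw [div_lt_iff₀ (by norm_num)] at h2
    linarith
  nlinarith [sq_nonneg (β - 0.8505), mul_le_mul_of_nonneg_right this (by linarith : 0 ≤ 1 + β)]

lemma I4a (w β l : ℝ) (hl : 0.6931 < l) (hw : 1.7 ≤ w) (hw' : w ≤ 2.3) (hb : 0 ≤ β) (hb1 : β ≤ 1)
    (h : 5 * β ^ 2 ≤ w * (1 + β)) :
    (7 / 64 * w - l * (1 - β)) * (w ^ 2 + 6 * w + 1) ≤ 3 * β * (w - 1) ^ 2 := by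
  apply Imono 3 (7 / 64) w β _ l (by norm_num) hl (by linarith) hw' (by linarith) (tang5 w β hb h)
  obtain ⟨s, rfl⟩ : ∃ s, w = 1.7 + s := ⟨w - 1.7, by ring⟩
  have hs : 0 ≤ s := by linarith
  have hq : 0 ≤ 0.6 - s := by linarith
  ring_nf
  nlinarith [pow_nonneg hs 3, mul_nonneg (pow_nonneg hs 2) hq, mul_nonneg hs (pow_nonneg hq 2),
    pow_nonneg hq 3, mul_nonneg hs hq, sq_nonneg (s - 0.46), mul_nonneg hs (sq_nonneg (s - 0.46))]

lemma I4b (w β l : ℝ) (hl : 0.6931 < l) (hw : 1.7 ≤ w) (hw' : w ≤ 2.3) (hb : 0 ≤ β) (hb1 : β ≤ 1)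
    (h : 5 * β ^ 2 ≤ w * (1 + β)) :
    (1 / 8 * w - l * (1 - β)) * (w ^ 2 + 6 * w + 1) ≤ 4 * β * (w - 1) ^ 2 := by
  apply Imono 4 (1 / 8) w β _ l (by norm_num) hl (by linarith) hw' (by linarith) (tang5 w β hb h)
  obtain ⟨s, rfl⟩ : ∃ s, w = 1.7 + s := ⟨w - 1.7, by ring⟩
  have hs : 0 ≤ s := by linarith
  have hq : 0 ≤ 0.6 - s := by linarith
  ring_nf
  nlinarith [pow_nonneg hs 3, mul_nonneg (pow_nonneg hs 2) hq, mul_nonneg hs (pow_nonneg hq 2),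
    pow_nonneg hq 3, mul_nonneg hs hq, sq_nonneg (s - 0.05), mul_nonneg hs (sq_nonneg (s - 0.05))]

lemma tang4 (w β : ℝ) (hb : 0 ≤ β) (h : 4 * β ^ 2 ≤ w * (1 + β)) : β ≤ (1 + w) / 3 := by
  have : 0 < 1 + β := by linarith
  by_contra hc
  push Not at hc
  nlinarith [sq_nonneg (β - 1)]

lemma I5 (w β l : ℝ) (hl : 0.6931 < l) (hl' : l < 0.6932) (hw : 1.4 ≤ w) (hw' : w ≤ 2.3)
    (hb : 0 ≤ β) (hb1 : β ≤ 1) (h : 4 * β ^ 2 ≤ w * (1 + β)) :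
    β ^ 2 * l * (w / 16 - l / 2 * (1 - β)) * (w ^ 2 + 6 * w + 1) ≤ w * (w - 1) ^ 2 := by
  have hD : 0 ≤ w ^ 2 + 6 * w + 1 := by positivity
  have key : ∀ β' : ℝ, β ≤ β' → β' ≤ 1 →
      β' ^ 2 * 0.6932 * (w / 16 - 0.6931 / 2 * (1 - β')) * (w ^ 2 + 6 * w + 1) ≤ w * (w - 1) ^ 2 →
      β ^ 2 * l * (w / 16 - l / 2 * (1 - β)) * (w ^ 2 + 6 * w + 1) ≤ w * (w - 1) ^ 2 := by
    intro β' hbb hb1' hh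
    have hx : w / 16 - l / 2 * (1 - β) ≤ w / 16 - 0.6931 / 2 * (1 - β') := by nlinarith
    by_cases hs : 0 ≤ w / 16 - l / 2 * (1 - β)
    · refine le_trans ?_ hh
      gcongr
    · have : β ^ 2 * l * (w / 16 - l / 2 * (1 - β)) * (w ^ 2 + 6 * w + 1) ≤ 0 := by
        apply mul_nonpos_of_nonpos_of_nonneg _ hD
        apply mul_nonpos_of_nonneg_of_nonpos (by positivity) (by linarith)
      refine this.trans (by positivity)
  by_cases h2 : w ≤ 2
  · apply key _ (tang4 w β hb h) (by linarith)
    have hp : 0 ≤ w - 1.4 := by linarith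
    have hq : 0 ≤ 2 - w := by linarith
    obtain ⟨s, rfl⟩ : ∃ s, w = 1.4 + s := ⟨w - 1.4, by ring⟩
    have hs : 0 ≤ s := by linarith
    have hs' : s ≤ 0.6 := by linarith
    ring_nf
    nlinarith [pow_nonneg hs 2, pow_nonneg hs 3, pow_nonneg hs 4, mul_nonneg hs hq,
      mul_nonneg (pow_nonneg hs 2) hq, mul_nonneg (pow_nonneg hs 3) hq, mul_nonneg (pow_nonneg hs 4) hq]
  · apply key 1 hb1 le_rfl
    nlinarith [mul_nonneg (sub_nonneg.2 hw') (by linarith : 0 ≤ w - 2), mul_nonneg (mul_nonneg (sub_nonneg.2 hw') (by linarith : 0 ≤ w - 2)) (by linarith : 0 ≤ w - 2)]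

lemma exp_taylor7 (μ : ℝ) (hμ : 0 ≤ μ) :
    1 + μ + μ ^ 2 / 2 + μ ^ 3 / 6 + μ ^ 4 / 24 + μ ^ 5 / 120 + μ ^ 6 / 720 + μ ^ 7 / 5040
      ≤ Real.exp μ := by
  have := Real.sum_le_exp_of_nonneg hμ 8
  simp only [Finset.sum_range_succ, Finset.sum_range_zero, Nat.factorial] at this
  norm_num at this
  linarith

lemma hinge_num (μ c c0 d : ℝ) (hμ : 0 ≤ μ) (hc : c ≤ c0)
    (hd : 2 + c0 * μ ≤ (d + 2 - μ) *
      (1 + μ + μ ^ 2 / 2 + μ ^ 3 / 6 + μ ^ 4 / 24 + μ ^ 5 / 120 + μ ^ 6 / 720 + μ ^ 7 / 5040))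
    (hd2 : 0 ≤ d + 2 - μ) :
    μ - 2 + Real.exp (-μ) * (2 + c * μ) ≤ d := by
  have h1 := exp_taylor7 μ hμ
  have h2 : 2 + c * μ ≤ (d + 2 - μ) * Real.exp μ := by
    have := mul_le_mul_of_nonneg_left h1 hd2
    nlinarith
  have h3 : Real.exp (-μ) * (2 + c * μ) ≤ d + 2 - μ := by
    calc _ ≤ Real.exp (-μ) * ((d + 2 - μ) * Real.exp μ) := by gcongr
      _ = (d + 2 - μ) * (Real.exp (-μ) * Real.exp μ) := by ring
      _ = d + 2 - μ := by rw [← Real.exp_add]; simp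
  linarith

lemma hinge_num1 (μ c : ℝ) (hμ : 0 ≤ μ) (hμ0 : μ ≤ 5 / 3) (hc : c ≤ 35 / 34) :
    μ - 2 + Real.exp (-μ) * (2 + c * μ) ≤ 1 / (1 + 1.7) := by
  apply hinge_num μ c (35 / 34) _ hμ hc _ (by norm_num; linarith)
  obtain ⟨s, rfl⟩ : ∃ s, μ = 5 / 3 - s := ⟨5 / 3 - μ, by ring⟩
  have hs : 0 ≤ s := by linarith
  have hs' : 0 ≤ 5 / 3 - s := by linarith
  ring_nf
  nlinarith [pow_nonneg hs 2, pow_nonneg hs 3, pow_nonneg hs 4, mul_nonneg hs hs',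
    mul_nonneg (pow_nonneg hs 2) hs', mul_nonneg (pow_nonneg hs 3) hs', mul_nonneg (pow_nonneg hs 4) hs',
    mul_nonneg (pow_nonneg hs 5) hs', mul_nonneg (pow_nonneg hs 6) hs', mul_nonneg (pow_nonneg hs 7) hs']

lemma hinge_num2 (μ c : ℝ) (hμ : 0 ≤ μ) (hμ0 : μ ≤ 1.6) (hc : c ≤ 56 / 55) :
    μ - 2 + Real.exp (-μ) * (2 + c * μ) ≤ 1 / (1 + 1.9) := by
  apply hinge_num μ c (56 / 55) _ hμ hc _ (by norm_num; linarith)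
  obtain ⟨s, rfl⟩ : ∃ s, μ = 1.6 - s := ⟨1.6 - μ, by ring⟩
  have hs : 0 ≤ s := by linarith
  have hs' : 0 ≤ 1.6 - s := by linarith
  ring_nf
  nlinarith [pow_nonneg hs 2, pow_nonneg hs 3, pow_nonneg hs 4, mul_nonneg hs hs',
    mul_nonneg (pow_nonneg hs 2) hs', mul_nonneg (pow_nonneg hs 3) hs', mul_nonneg (pow_nonneg hs 4) hs',
    mul_nonneg (pow_nonneg hs 5) hs', mul_nonneg (pow_nonneg hs 6) hs', mul_nonneg (pow_nonneg hs 7) hs']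

lemma tail_v (p : ℝ) (h0 : 0 ≤ p) (h1 : p ≤ 1) (m : ℕ) (μ β : ℝ) (hμ : μ = m * p)
    (hμ0 : 0 < μ) (hβ : 0 < β) :
    BinE p m (fun x => if μ * (1 + β) < (x : ℝ) then 1 else 0) ≤ 1 / (1 + β ^ 2 * μ) := by
  apply tail_cantelli p h0 h1 m _ (μ * (1 + β)) μ hμ hμ0 (by nlinarith) (fun x hx => hx.le) _
    (by positivity)
  nlinarith

lemma tail_int (p : ℝ) (h0 : 0 ≤ p) (h1 : p ≤ 1) (m : ℕ) (μ β : ℝ) (hμ : μ = m * p)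
    (hμ0 : 0 < μ) (hβ : 0 < β) (j : ℕ) (hj : (j : ℝ) ≤ μ * (1 + β)) :
    BinE p m (fun x => if μ * (1 + β) < (x : ℝ) then 1 else 0)
      ≤ 1 / (1 + max (β ^ 2 * μ) ((j + 1) * β ^ 2 / (1 + β))) := by
  rcases le_total ((j + 1) * β ^ 2 / (1 + β)) (β ^ 2 * μ) with h | h
  · rw [max_eq_left h]
    exact tail_v p h0 h1 m μ β hμ hμ0 hβ
  · rw [max_eq_right h]
    have hb : 0 < 1 + β := by linarith
    rw [le_div_iff₀ hb] at h
    have hμj : μ * (1 + β) ≤ j + 1 := by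
      have : β ^ 2 * (μ * (1 + β)) ≤ β ^ 2 * (j + 1) := by linarith
      exact le_of_mul_le_mul_left this (by positivity)
    have hjp : (0 : ℝ) < j + 1 := by positivity
    apply tail_cantelli p h0 h1 m _ (j + 1) μ hμ hμ0 (by nlinarith)
    · intro x hx
      have : (j : ℝ) < x := by linarith
      have h2 : j < x := by exact_mod_cast this
      exact_mod_cast h2
    · positivity
    · have e1 : (j + 1) * β ^ 2 / (1 + β) * μ = β ^ 2 * ((j + 1) * (μ / (1 + β))) := by
        field_simp
      -- with `J = j + 1` and `μ ≤ J / (1 + β)`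
      set r : ℝ := ((j : ℝ) + 1) / (1 + β) with hr
      have e2 : (j : ℝ) + 1 = r * (1 + β) := by rw [hr]; field_simp
      have e3 : ((j : ℝ) + 1) * β ^ 2 / (1 + β) * μ = β ^ 2 * (r * μ) := by
        rw [hr]; field_simp
      have hμr : μ ≤ r := by rw [hr, le_div_iff₀ hb]; exact hμj
      rw [e3, e2]
      have h5 : β * r ≤ r * (1 + β) - μ := by linarith
      have h6 : (β * r) ^ 2 ≤ (r * (1 + β) - μ) ^ 2 := by
        apply pow_le_pow_left₀ _ h5
        have : 0 < r := by linarith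
        positivity
      have h7 : β ^ 2 * (r * μ) ≤ β ^ 2 * (r * r) := by
        have : 0 < r := by linarith
        gcongr
      nlinarith

set_option maxHeartbeats 2000000 in
lemma core (n m L t : ℕ) (p μ β z c q βs : ℝ)
    (hcq : (c = 3 ∧ q = 7 / 64 ∧ βs = 0.8148) ∨ (c = 4 ∧ q = 1 / 8 ∧ βs = 0.8))
    (h0 : 0 ≤ p) (hp : p ≤ (1 - β) / 7) (hμ : μ = m * p) (hμ0 : 0 < μ)
    (hβ : 2 / 3 < β) (hβ1 : β < 1)
    (hz : z = β ^ 2 * Real.log 2 * n / 16) (hzq : (1 - β) * z ≤ q * (β ^ 2 * μ))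
    (hL : c * β ≤ (1 - β) * L) (ht1 : 1 ≤ t) (hTt : βs ≤ β → 2 * (t : ℝ) ≤ μ * (1 + β))
    (hL1 : t = 1 → L = n) (hμn : Real.log 2 / 2 * (1 - β) * n ≤ μ) :
    z ≤ Real.log 2 ∨ ∃ w : ℝ, 1 ≤ w ∧
      BinE p m (fun x => if μ * (1 + β) < (x : ℝ) then 1 else 0) ≤ 1 / (1 + w) ∧
      z - Real.log 2 ≤ L * Gf w := by
  set l := Real.log 2 with hl
  have hl1 : 0.6931 < l := by have := Real.log_two_gt_d9; linarith
  have hl2 : l < 0.6932 := by have := Real.log_two_lt_d9; linarith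
  have hp1 : p ≤ 1 := by linarith
  have hβ0 : 0 < β := by linarith
  have hb1 : 0 < 1 - β := by linarith
  have hc0 : 0 < c := by rcases hcq with ⟨rfl, _, _⟩ | ⟨rfl, _, _⟩ <;> norm_num
  have hq0 : 0 < q := by rcases hcq with ⟨_, rfl, _⟩ | ⟨_, rfl, _⟩ <;> norm_num
  set v := β ^ 2 * μ with hv
  have hv0 : 0 < v := by positivity
  have fin0 : ∀ G w : ℝ, 0 ≤ G → v ≤ w → q * w - l * (1 - β) ≤ c * β * G →
      z - l ≤ L * G := by
    intro G w hG hvw h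
    have h1 : c * β * G ≤ (1 - β) * L * G := mul_le_mul_of_nonneg_right hL hG
    have h2 : q * v ≤ q * w := by gcongr
    have h3 : (1 - β) * (z - l) ≤ (1 - β) * (L * G) := by nlinarith
    exact le_of_mul_le_mul_left h3 hb1
  have finK : ∀ w : ℝ, 1 ≤ w → v ≤ w →
      (q * w - l * (1 - β)) * (w ^ 2 + 6 * w + 1) ≤ c * β * (w - 1) ^ 2 →
      z - l ≤ L * Gf w := by
    intro w hw hvw h
    have hG := Gf_ge w hw
    have hD : 0 < w ^ 2 + 6 * w + 1 := by positivity
    have hK : 0 ≤ (w - 1) ^ 2 / (w ^ 2 + 6 * w + 1) := by positivity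
    apply fin0 _ w (hK.trans hG) hvw
    have h2 : q * w - l * (1 - β) ≤ c * β * ((w - 1) ^ 2 / (w ^ 2 + 6 * w + 1)) := by
      rw [← mul_div_assoc, le_div_iff₀ hD]; exact h
    refine h2.trans ?_
    gcongr
  -- large `v`
  by_cases hv5 : 5.4 ≤ v
  · right
    have hI : q * v - l * (1 - β) ≤ c * β * (v / (2 + β) / 2 - l) := by
      rcases hcq with ⟨rfl, rfl, _⟩ | ⟨rfl, rfl, _⟩
      · exact I1a v β l hl1 hl2 hv5 hβ.le hβ1.le
      · exact I1b v β l hl1 hl2 hv5 hβ.le hβ1.le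
    have hR : 1.8 ≤ v / (2 + β) := by
      rw [le_div_iff₀ (by linarith)]; linarith
    have h2 : 2 ≤ Real.exp (v / (2 + β)) := by
      have := Real.add_one_le_exp (v / (2 + β)); linarith
    have hG := Gf_exp (v / (2 + β)) (by linarith)
    refine ⟨Real.exp (v / (2 + β)) - 1, by linarith, ?_, ?_⟩
    · have := tail_chernoff p h0 hp1 m μ β hμ hβ0.le
      refine this.trans (le_of_eq ?_)
      rw [Real.exp_neg]
      simp
      rfl
    · apply fin0 _ v (by linarith) le_rfl
      refine hI.trans ?_
      have : 0 ≤ c * β := by positivity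
      exact mul_le_mul_of_nonneg_left hG this
  push Not at hv5
  have finM : ∀ w : ℝ, 2.3 ≤ w → w ≤ 5.4 → v ≤ w → z - l ≤ L * Gf w := by
    intro w hw hw' hvw
    apply finK w (by linarith) hvw
    rcases hcq with ⟨rfl, rfl, _⟩ | ⟨rfl, rfl, _⟩
    · exact I2a w β l hl1 hw hw' hβ0.le hβ1.le
    · exact I2b w β l hl1 hw hw' hβ0.le hβ1.le
  by_cases hvm : 2.3 ≤ v
  · right
    exact ⟨v, by linarith, tail_v p h0 hp1 m μ β hμ hμ0 hβ0, finM v hvm hv5.le le_rfl⟩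
  push Not at hvm
  by_cases hbs : β < βs
  · by_cases hv1 : v < 1
    · left
      have : (1 - β) * z ≤ (1 - β) * l := by
        rcases hcq with ⟨rfl, rfl, rfl⟩ | ⟨rfl, rfl, rfl⟩ <;> nlinarith
      exact le_of_mul_le_mul_left this hb1
    · push Not at hv1
      right
      refine ⟨v, hv1, tail_v p h0 hp1 m μ β hμ hμ0 hβ0, finK v hv1 le_rfl ?_⟩
      rcases hcq with ⟨rfl, rfl, rfl⟩ | ⟨rfl, rfl, rfl⟩
      · exact I3a v β l hl1 hv1 hvm.le hbs.le
      · exact I3b v β l hl1 hv1 hvm.le hbs.le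
  push Not at hbs
  have hβ8 : 0.8 ≤ β := by rcases hcq with ⟨_, _, rfl⟩ | ⟨_, _, rfl⟩ <;> linarith
  have hT := hTt hbs
  right
  by_cases ht : 2 ≤ t
  · have ht' : (2 : ℝ) ≤ t := by exact_mod_cast ht
    have hd := tail_int p h0 hp1 m μ β hμ hμ0 hβ0 4 (by push_cast; linarith)
    set w := max v ((((4 : ℕ) : ℝ) + 1) * β ^ 2 / (1 + β)) with hw
    have hw5 : 5 * β ^ 2 / (1 + β) ≤ w := by
      refine le_trans (le_of_eq ?_) (le_max_right _ _)
      norm_num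
    have hvw : v ≤ w := le_max_left _ _
    have hwu : w ≤ 5.4 := by
      apply max_le hv5.le
      rw [div_le_iff₀ (by linarith)]
      push_cast
      nlinarith
    rw [div_le_iff₀ (by linarith)] at hw5
    have hwl : 1.7 ≤ w := by nlinarith
    refine ⟨w, by linarith, hd, ?_⟩
    by_cases hwm : 2.3 ≤ w
    · exact finM w hwm hwu hvw
    · push Not at hwm
      apply finK w (by linarith) hvw
      rcases hcq with ⟨rfl, rfl, _⟩ | ⟨rfl, rfl, _⟩
      · exact I4a w β l hl1 hwl hwm.le hβ0.le hβ1.le hw5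
      · exact I4b w β l hl1 hwl hwm.le hβ0.le hβ1.le hw5
  have ht1' : t = 1 := by omega
  have hLn := hL1 ht1'
  subst ht1'
  subst hLn
  push_cast at hT
  have hn0 : (0 : ℝ) ≤ L := Nat.cast_nonneg L
  by_cases hT3 : 3 ≤ μ * (1 + β)
  · have hd := tail_int p h0 hp1 m μ β hμ hμ0 hβ0 3 (by push_cast; linarith)
    set w := max v ((((3 : ℕ) : ℝ) + 1) * β ^ 2 / (1 + β)) with hw
    have hw5 : 4 * β ^ 2 / (1 + β) ≤ w := by
      refine le_trans (le_of_eq ?_) (le_max_right _ _)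
      norm_num
    have hvw : v ≤ w := le_max_left _ _
    have hwu : w ≤ 5.4 := by
      apply max_le hv5.le
      rw [div_le_iff₀ (by linarith)]
      push_cast
      nlinarith
    rw [div_le_iff₀ (by linarith)] at hw5
    have hwl : 1.4 ≤ w := by nlinarith
    refine ⟨w, by linarith, hd, ?_⟩
    by_cases hwm : 2.3 ≤ w
    · exact finM w hwm hwu hvw
    · push Not at hwm
      have hI := I5 w β l hl1 hl2 hwl hwm.le hβ0.le hβ1.le hw5
      have hG := Gf_ge w (by linarith)
      have hD : 0 < w ^ 2 + 6 * w + 1 := by positivity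
      have hI2 : β ^ 2 * l * (w / 16 - l / 2 * (1 - β)) ≤ w * Gf w := by
        have : β ^ 2 * l * (w / 16 - l / 2 * (1 - β)) ≤ w * ((w - 1) ^ 2 / (w ^ 2 + 6 * w + 1)) := by
          rw [← mul_div_assoc, le_div_iff₀ hD]; exact hI
        refine this.trans ?_
        have : 0 ≤ w := by linarith
        gcongr
      -- `L * (l β²/2 (1-β)) ≤ v ≤ w`
      have hN : L * (l * β ^ 2 / 2 * (1 - β)) ≤ w := by
        have := mul_le_mul_of_nonneg_left hμn (sq_nonneg β)
        nlinarith
      by_cases hs : β ^ 2 * l / 16 ≤ Gf w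
      · have := mul_le_mul_of_nonneg_left hs hn0
        rw [hz]
        nlinarith
      · push Not at hs
        have hs' : 0 ≤ β ^ 2 * l / 16 - Gf w := by linarith
        have hX : w * (β ^ 2 * l / 16 - Gf w) ≤ l * (l * β ^ 2 / 2 * (1 - β)) := by nlinarith
        have hY := mul_le_mul_of_nonneg_right hN hs'
        have hpos : 0 < l * β ^ 2 / 2 * (1 - β) := by positivity
        have hZ : (l * β ^ 2 / 2 * (1 - β)) * (L * (β ^ 2 * l / 16 - Gf w))
            ≤ (l * β ^ 2 / 2 * (1 - β)) * l := by nlinarith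
        have := le_of_mul_le_mul_left hZ hpos
        rw [hz]
        nlinarith
  · push Not at hT3
    have hd := tail_hinge p h0 (by linarith) m (μ * (1 + β)) μ hμ (by linarith)
    have e : μ / (1 - p) = (1 / (1 - p)) * μ := by ring
    rw [e] at hd
    have fin1 : ∀ w : ℝ, 1 ≤ w → β ^ 2 * l / 16 ≤ (w - 1) ^ 2 / (w ^ 2 + 6 * w + 1) →
        z - l ≤ L * Gf w := by
      intro w hw h
      have := mul_le_mul_of_nonneg_left (h.trans (Gf_ge w hw)) hn0
      rw [hz]
      nlinarith
    by_cases hb : β ≤ 0.875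
    · refine ⟨1.7, by norm_num, hd.trans ?_, fin1 1.7 (by norm_num) ?_⟩
      · apply hinge_num1 μ _ hμ0.le (by nlinarith)
        rw [div_le_iff₀ (by linarith)]
        linarith
      · have : β ^ 2 ≤ 0.875 ^ 2 := by gcongr
        norm_num at this ⊢
        nlinarith
    · push Not at hb
      refine ⟨1.9, by norm_num, hd.trans ?_, fin1 1.9 (by norm_num) ?_⟩
      · apply hinge_num2 μ _ hμ0.le (by nlinarith)
        rw [div_le_iff₀ (by linarith)]
        linarith
      · have : β ^ 2 ≤ 1 ^ 2 := by gcongr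
        norm_num at this ⊢
        nlinarith

set_option maxHeartbeats 2000000

/-- Let `k > 2`, `m = (ln 2·2^k − x)n` with `x < ln 2·2^k/2`, and `0 ≤ α < 1/2`
with `αn = t` an integer.  Fix an assignment `a` and let `T̃ = m(1−(1−α)^{2k})/(2^k−1)`.  For a
formula `φ`, let `S_{αn}(φ)` be the set of assignments at Hamming distance at most `αn` from
`a` leaving more than `T̃` clauses of `φ` unsatisfied.  Then for `φ` drawn from the planted
distribution `D_pa(m,n,k,a)` (uniform over formulas all of whose clauses are satisfied by `a`),
`Pr[|S_{αn}(φ)| > |H(a,α,n)|/2] ≤ 2·e^{−(1−α)^{2k}·ln 2·n/16}`. -/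
theorem planted_bad_formula_bound (n k m : ℕ) (hn : 0 < n) (hk : 2 < k) (hm : 0 < m)
    (x : ℝ) (hx : x < Real.log 2 * 2 ^ k / 2)
    (hmval : (m : ℝ) = (Real.log 2 * 2 ^ k - x) * n)
    (α : ℝ) (hα0 : 0 ≤ α) (hα1 : α < 1 / 2) (t : ℕ) (ht : (t : ℝ) = α * n)
    (a : Assignment n) :
    let T : ℝ := m * (1 - (1 - α) ^ (2 * k)) / (2 ^ k - 1)
    let Hset : Finset (Assignment n) := univ.filter fun h => hammingDist a h ≤ t
    let Pform : Finset (Formula n k m) := univ.filter fun φ => SatFormula a φ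
    ((Pform.filter fun φ =>
        ((Hset.filter fun h => T < (numUnsat φ h : ℝ)).card : ℝ)
          > (Hset.card : ℝ) / 2).card : ℝ) / (Pform.card : ℝ)
      ≤ 2 * Real.exp (-(1 - α) ^ (2 * k) * Real.log 2 * n / 16) := by
  intro T Hset Pform
  set l := Real.log 2 with hl
  have hl1 : 0.6931 < l := by have := Real.log_two_gt_d9; linarith
  have hl2 : l < 0.6932 := by have := Real.log_two_lt_d9; linarith
  have hnR : (0 : ℝ) < n := by exact_mod_cast hn
  obtain ⟨b, hb⟩ : ∃ b, b = 1 - α := ⟨_, rfl⟩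
  obtain ⟨β, hβ⟩ : ∃ β, β = b ^ k := ⟨_, rfl⟩
  have hα : α = 1 - b := by linarith
  have hb0 : 0 < b := by linarith
  have hb1 : b ≤ 1 := by linarith
  have hβ0 : 0 < β := by rw [hβ]; positivity
  have hβ1 : β ≤ 1 := by rw [hβ]; exact pow_le_one₀ hb0.le hb1
  have hpow : (1 - α) ^ (2 * k) = β ^ 2 := by rw [hβ, ← hb, ← pow_mul, mul_comm]
  set Q := Pform.filter fun φ =>
        ((Hset.filter fun h => T < (numUnsat φ h : ℝ)).card : ℝ)
          > (Hset.card : ℝ) / 2 with hQ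
  obtain ⟨z, hz⟩ : ∃ z, z = β ^ 2 * l * n / 16 := ⟨_, rfl⟩
  have hrhs : -(1 - α) ^ (2 * k) * l * n / 16 = -z := by rw [hpow, hz]; ring
  rw [hrhs]
  have hP0 : (0 : ℝ) ≤ Pform.card := Nat.cast_nonneg _
  suffices hmain : (Q.card : ℝ) ≤ Pform.card * (2 * Real.exp (-z)) by
    apply div_le_of_le_mul₀ hP0 (by positivity)
    linarith
  have htriv : z ≤ l → (Q.card : ℝ) ≤ Pform.card * (2 * Real.exp (-z)) := by
    intro h
    have h1 : (Q.card : ℝ) ≤ Pform.card := by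
      exact_mod_cast Finset.card_le_card (Finset.filter_subset _ _)
    have h2 : 1 ≤ 2 * Real.exp (-z) := by
      have : Real.exp (-l) ≤ Real.exp (-z) := Real.exp_le_exp.mpr (by linarith)
      rw [Real.exp_neg, hl, Real.exp_log (by norm_num)] at this
      linarith
    exact h1.trans (le_mul_of_one_le_right hP0 h2)
  -- the degenerate case `t = 0`
  by_cases ht0 : t = 0
  · have hα00 : α = 0 := by
      rw [ht0] at ht
      push_cast at ht
      rcases mul_eq_zero.mp ht.symm with h | h
      · exact h
      · linarith
    have hT0 : T = 0 := by simp [T, hα00]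
    have hQ0 : Q = ∅ := by
      rw [hQ, Finset.filter_eq_empty_iff]
      intro φ hφ hgt
      have hsat : SatFormula a φ := (mem_filter.mp hφ).2
      have he : (Hset.filter fun h => T < (numUnsat φ h : ℝ)) = ∅ := by
        rw [Finset.filter_eq_empty_iff]
        intro h hh hlt
        have hd : hammingDist a h ≤ t := (mem_filter.mp hh).2
        rw [ht0] at hd
        have hah : a = h := hammingDist_eq_zero.mp (Nat.le_zero.mp hd)
        subst hah
        have hnu : numUnsat φ a = 0 := by
          unfold numUnsat
          rw [Finset.card_eq_zero, Finset.filter_eq_empty_iff]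
          intro j _ hj
          exact hj (hsat j)
        rw [hnu, hT0] at hlt
        simp at hlt
      rw [he] at hgt
      have : (0 : ℝ) ≤ Hset.card := Nat.cast_nonneg _
      simp only [card_empty, Nat.cast_zero] at hgt
      linarith
    rw [hQ0]
    rw [card_empty, Nat.cast_zero]
    exact mul_nonneg hP0 (mul_nonneg zero_le_two (Real.exp_pos _).le)
  have ht1 : 1 ≤ t := Nat.one_le_iff_ne_zero.mpr ht0
  have ht1R : (1 : ℝ) ≤ t := by exact_mod_cast ht1
  have hαpos : 0 < α := by
    by_contra h
    have : α = 0 := by linarith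
    rw [this] at ht
    linarith
  have hb1' : b < 1 := by linarith
  have hβ1' : β < 1 := by rw [hβ]; exact pow_lt_one₀ hb0.le hb1' (by omega)
  have h2k : (8 : ℝ) ≤ 2 ^ k := by
    calc (8 : ℝ) = 2 ^ 3 := by norm_num
      _ ≤ 2 ^ k := pow_le_pow_right₀ (by norm_num) (by omega)
  have hden : (0 : ℝ) < 2 ^ k - 1 := by linarith
  obtain ⟨p, hp⟩ : ∃ p : ℝ, p = (1 - β) / (2 ^ k - 1) := ⟨_, rfl⟩
  have hp0 : 0 < p := by rw [hp]; apply div_pos _ hden; linarith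
  have hp7 : p ≤ (1 - β) / 7 := by
    rw [hp]
    apply div_le_div_of_nonneg_left _ _ _ <;> linarith
  have hp1 : p ≤ 1 := by linarith
  obtain ⟨μ, hμ⟩ : ∃ μ : ℝ, μ = m * p := ⟨_, rfl⟩
  have hmR : (0 : ℝ) < m := by exact_mod_cast hm
  have hμ0 : 0 < μ := by rw [hμ]; positivity
  have hTμ : T = μ * (1 + β) := by
    change (m : ℝ) * (1 - (1 - α) ^ (2 * k)) / (2 ^ k - 1) = μ * (1 + β)
    rw [hpow, hμ, hp]
    ring
  have hm2 : l * 2 ^ k / 2 * n ≤ m := by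
    rw [hmval]
    apply mul_le_mul_of_nonneg_right _ hnR.le
    linarith
  have hμden : μ * (2 ^ k - 1) = m * (1 - β) := by
    rw [hμ, hp]; field_simp
  have hμk : l * 2 ^ k / 2 * n * (1 - β) ≤ μ * (2 ^ k - 1) := by
    rw [hμden]
    apply mul_le_mul_of_nonneg_right hm2
    linarith
  have hμn : l / 2 * (1 - β) * n ≤ μ := by
    have h1 : l / 2 * (1 - β) * n * (2 ^ k - 1) ≤ μ * (2 ^ k - 1) := by
      have : 0 ≤ l / 2 * (1 - β) * n := by
        have : 0 ≤ 1 - β := by linarith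
        positivity
      linarith
    exact le_of_mul_le_mul_right h1 hden
  have htn : t ≤ n := by
    have : (t : ℝ) ≤ n := by rw [ht]; exact mul_le_of_le_one_left hnR.le (by linarith)
    exact_mod_cast this
  have hcard : ∀ D : Finset (Fin n), D.card ≤ t →
      (((univ.filter fun c : Clause n k => SatClause a c).filter
        fun c => ¬ SatClause (flipOn a D) c).card : ℝ)
        ≤ p * (univ.filter fun c : Clause n k => SatClause a c).card := by
    intro D hD
    have h1 := sat_card (k := k) a
    have h2 := sat_not_sat_card (k := k) a D
    have h1R : ((univ.filter fun c : Clause n k => SatClause a c).card : ℝ) = (2 ^ k - 1) * n ^ k := by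
      have : ((univ.filter fun c : Clause n k => SatClause a c).card : ℝ) + n ^ k = (2 * n) ^ k := by
        exact_mod_cast h1
      rw [mul_pow] at this
      linarith
    have h2R : (((univ.filter fun c : Clause n k => SatClause a c).filter
        fun c => ¬ SatClause (flipOn a D) c).card : ℝ) + ((n - D.card : ℕ) : ℝ) ^ k = n ^ k := by
      exact_mod_cast h2
    have h3 : (b * n) ^ k ≤ ((n - D.card : ℕ) : ℝ) ^ k := by
      apply pow_le_pow_left₀ (by positivity)
      rw [Nat.cast_sub (hD.trans htn)]
      have : (D.card : ℝ) ≤ t := by exact_mod_cast hD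
      rw [ht] at this
      rw [hb]
      linarith
    rw [mul_pow, ← hβ] at h3
    have h4 : p * ((2 ^ k - 1) * n ^ k) = (1 - β) * n ^ k := by
      rw [hp]; field_simp
    rw [h1R, h4]
    linarith
  have hδ0 : 0 ≤ BinE p m (fun x => if T < (x : ℝ) then 1 else 0) := by
    apply BinE_nonneg hp0.le hp1
    intro x
    split_ifs <;> norm_num
  have hmarkov : (Q.card : ℝ) ≤ Pform.card *
      (2 * BinE p m (fun x => if T < (x : ℝ) then 1 else 0)) :=
    count_bound_markov (m := m) a T t p hp0.le hp1 hcard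
  have hblock : ∀ (L : ℕ), L * t ≤ n → ∀ w : ℝ, 1 ≤ w →
      (Q.card : ℝ) * Real.exp (Real.log w * L / 2) ≤ Pform.card *
      (1 + (w - 1) * BinE p m (fun x => if T < (x : ℝ) then 1 else 0)) ^ L := fun L hL w hw =>
    count_bound (m := m) a T t L hL p hp0.le hp1 hcard w hw
  clear hcard
  clear_value Q Pform Hset T
  by_cases hcase : β ≤ 2 / 3
  · have h1 := hmarkov
    have h2 := tail_chernoff p hp0.le hp1 m μ β hμ hβ0.le
    rw [← hTμ] at h2
    have h3 : z ≤ β ^ 2 * μ / (2 + β) := by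
      rw [le_div_iff₀ (by linarith), hz]
      have h4 : β ^ 2 * (l / 2 * (1 - β) * n) ≤ β ^ 2 * μ := by gcongr
      have h5 : 0 ≤ β ^ 2 * l * n := by positivity
      have h6 := mul_nonneg h5 (by linarith : 0 ≤ 2 / 3 - β)
      linarith
    have h4 : Real.exp (-(β ^ 2 * μ / (2 + β))) ≤ Real.exp (-z) :=
      Real.exp_le_exp.mpr (by linarith)
    refine h1.trans ?_
    apply mul_le_mul_of_nonneg_left _ hP0
    linarith
  push Not at hcase
  -- the block case
  have hLt : (n / t) * t ≤ n := Nat.div_mul_le_self n t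
  have hLlow : b ≤ α * ((n / t : ℕ) : ℝ) := by
    have h1 : n < (n / t + 1) * t := by
      have := Nat.lt_div_mul_add (a := n) (b := t) ht1
      rw [Nat.add_mul, one_mul]
      exact this
    have h2 : (n : ℝ) < (((n / t : ℕ) : ℝ) + 1) * t := by exact_mod_cast h1
    rw [ht] at h2
    have h3 : 1 * (n : ℝ) < ((((n / t : ℕ) : ℝ) + 1) * α) * n := by linarith
    have h4 := lt_of_mul_lt_mul_right h3 hnR.le
    linarith
  obtain ⟨S, hS⟩ : ∃ S : ℝ, S = ∑ i ∈ Finset.range k, b ^ i := ⟨_, rfl⟩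
  have hSα : α * S = 1 - β := by
    rw [hS, hα, hβ]
    exact mul_neg_geom_sum b k
  have hS0 : 0 ≤ S := by rw [hS]; exact Finset.sum_nonneg (fun i _ => pow_nonneg hb0.le i)
  have hSb : k * β ≤ S * b := by
    rw [hS, Finset.sum_mul, hβ]
    calc (k : ℝ) * b ^ k = ∑ i ∈ Finset.range k, b ^ k := by simp
      _ ≤ _ := by
        apply Finset.sum_le_sum
        intro i hi
        rw [← pow_succ]
        apply pow_le_pow_of_le_one hb0.le hb1
        have := Finset.mem_range.mp hi
        omega
  have hLk : k * β ≤ (1 - β) * ((n / t : ℕ) : ℝ) := by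
    rw [← hSα]
    have := mul_le_mul_of_nonneg_left hLlow hS0
    linarith
  have hcore : z ≤ l ∨ ∃ w : ℝ, 1 ≤ w ∧
      BinE p m (fun x => if μ * (1 + β) < (x : ℝ) then 1 else 0) ≤ 1 / (1 + w) ∧
      z - l ≤ ((n / t : ℕ) : ℝ) * Gf w := by
    have hL1 : t = 1 → n / t = n := by intro h; rw [h, Nat.div_one]
    have hnt : α * n = t := ht.symm
    by_cases hk3 : k = 3
    · have hμ3 : 4 * l / 7 * ((1 - β) * n) ≤ μ := by
        rw [hk3] at hμk
        norm_num at hμk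
        linarith
      apply core n m (n / t) t p μ β z 3 (7 / 64) 0.8148 (Or.inl ⟨rfl, rfl, rfl⟩) hp0.le hp7 hμ hμ0
        hcase hβ1' hz _ _ ht1 _ hL1 hμn
      · rw [hz]
        have := mul_le_mul_of_nonneg_left hμ3 (sq_nonneg β)
        linarith
      · rw [hk3] at hLk
        push_cast at hLk
        exact hLk
      · intro hbs
        have hβ3 : β = b ^ 3 := by rw [hβ, hk3]
        have hS3 : S = 1 + b + b ^ 2 := by
          rw [hS, hk3]
          simp [Finset.sum_range_succ]
        have hb9 : 0.934 ≤ b := by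
          by_contra h
          push Not at h
          have : b ^ 3 ≤ 0.934 ^ 3 := by gcongr
          rw [← hβ3] at this
          norm_num at this
          linarith
        have e : (1 - β) * n = t * S := by rw [← hSα, ← hnt]; ring
        rw [e] at hμ3
        have h5 : 0.934 ^ 2 ≤ b ^ 2 := by gcongr
        have h6 : 2.8063 ≤ S := by rw [hS3]; norm_num at h5 ⊢; linarith
        have h7 : 4 * 0.6931 / 7 * (t * 2.8063) ≤ 4 * l / 7 * (t * S) := by gcongr
        have h8 : μ * 1.8 ≤ μ * (1 + β) := mul_le_mul_of_nonneg_left (by linarith) hμ0.le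
        linarith
    · have hk4 : 4 ≤ k := by omega
      have hk4R : (4 : ℝ) ≤ k := by exact_mod_cast hk4
      apply core n m (n / t) t p μ β z 4 (1 / 8) 0.8 (Or.inr ⟨rfl, rfl, rfl⟩) hp0.le hp7 hμ hμ0
        hcase hβ1' hz _ _ ht1 _ hL1 hμn
      · rw [hz]
        have := mul_le_mul_of_nonneg_left hμn (sq_nonneg β)
        linarith
      · refine le_trans ?_ hLk
        gcongr
      · intro hbs
        have hS4 : 1 + 3 * β ≤ S := by
          have h1 : 1 + b + b ^ 2 + b ^ 3 ≤ S := by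
            have : ∑ i ∈ Finset.range 4, b ^ i ≤ ∑ i ∈ Finset.range k, b ^ i := by
              apply Finset.sum_le_sum_of_subset_of_nonneg
              · exact Finset.range_subset_range.mpr hk4
              · intro i _ _
                positivity
            rw [← hS] at this
            simp only [Finset.sum_range_succ, Finset.sum_range_zero] at this
            linarith
          have h2 : ∀ i, i ≤ k → β ≤ b ^ i := by
            intro i hi
            rw [hβ]
            exact pow_le_pow_of_le_one hb0.le hb1 hi
          have h3 := h2 1 (by omega)
          have h4 := h2 2 (by omega)
          have h5 := h2 3 (by omega)
          rw [pow_one] at h3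
          linarith
        have e : (1 - β) * n = t * S := by rw [← hSα, ← hnt]; ring
        have hμ4 : l / 2 * (t * S) ≤ μ := by rw [← e]; linarith
        have h7 : 0.6931 / 2 * (t * 3.4) ≤ l / 2 * (t * S) := by
          have : 3.4 ≤ S := by linarith
          gcongr
        have h8 : μ * 1.8 ≤ μ * (1 + β) := mul_le_mul_of_nonneg_left (by linarith) hμ0.le
        linarith
  rcases hcore with h | ⟨w, hw1, hδ, hG⟩
  · exact htriv h
  rw [← hTμ] at hδ
  have h1 := hblock (n / t) hLt w hw1
  have h2 := block_exp (Q.card : ℝ) (Pform.card : ℝ) _ w (n / t) hP0 hδ0 hδ hw1 h1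
  refine h2.trans ?_
  apply mul_le_mul_of_nonneg_left _ hP0
  calc Real.exp (-(((n / t : ℕ) : ℝ) * Gf w)) ≤ Real.exp (l + -z) :=
        Real.exp_le_exp.mpr (by linarith)
    _ = 2 * Real.exp (-z) := by rw [Real.exp_add, hl, Real.exp_log (by norm_num)]
end

section
/- Let k ≥ 60 and let m = (ln(2)·2^k − c)·n where c < ln(2)·2^k/2. Let 0 ≤ α < 1/2 with αn a positive integer, and let p_sat > 0 be the probability that a formula drawn from D_R(m,n,k) is satisfiable. Draw φ from D_S(m,n,k) and, independently, draw a sequence of ⌈2n^2·2^n/C(n, αn)⌉ assignments i.i.d. uniformly from {0,1}^n. Then with probability at least 1 − e^{cn/2^k}·2·e^{−(1−α)^{2k}·ln(2)·n/16}/p_sat − e^{−n^2}, some assignment h in the sequence simultaneously (a) has Hamming distance at most αn from some satisfying assignment of φ, and (b) satisfies NumClausesSAT(φ, h) ≥ (1 − (1−(1−α)^{2k})/(2^k−1))·m. -/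
open scoped Classical
open Finset

/-- Flip the coordinates of `a` lying in `D`. -/
def flipAt {n : ℕ} (a : Assignment n) (D : Finset (Fin n)) : Assignment n :=
  fun i => if i ∈ D then !(a i) else a i

lemma flipAt_inj {n : ℕ} (a : Assignment n) : Function.Injective (flipAt a) := by
  intro D D' h
  ext i
  have := congrFun h i
  unfold flipAt at this
  by_cases h1 : i ∈ D <;> by_cases h2 : i ∈ D' <;> simp_all

lemma flipAt_dist {n : ℕ} (a : Assignment n) (D : Finset (Fin n)) :
    hammingDist (flipAt a D) a = D.card := by
  unfold hammingDist flipAt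
  congr 1
  ext i
  by_cases h : i ∈ D <;> simp [h]

lemma card_lits {n : ℕ} (v : Assignment n) (A : Finset (Fin n)) :
    ((univ : Finset (Fin n × Bool)).filter fun l => l.1 ∈ A ∧ v l.1 ≠ l.2).card = A.card := by
  have : ((univ : Finset (Fin n × Bool)).filter fun l => l.1 ∈ A ∧ v l.1 ≠ l.2)
      = A.image (fun i => (i, !(v i))) := by
    ext ⟨i, b⟩
    simp only [mem_filter, mem_univ, true_and, mem_image, Prod.mk.injEq]
    constructor
    · rintro ⟨h1, h2⟩
      refine ⟨i, h1, rfl, ?_⟩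
      cases b <;> cases hv : v i <;> simp_all
    · rintro ⟨j, h1, rfl, rfl⟩
      exact ⟨h1, by simp⟩
  rw [this, card_image_of_injective]
  intro i j h
  simpa using congrArg Prod.fst h

lemma card_cl {n k : ℕ} (v : Assignment n) (A : Finset (Fin n)) :
    ((univ : Finset (Clause n k)).filter fun c => ∀ i, (c i).1 ∈ A ∧ v (c i).1 ≠ (c i).2).card
      = A.card ^ k := by
  have : ((univ : Finset (Clause n k)).filter fun c => ∀ i, (c i).1 ∈ A ∧ v (c i).1 ≠ (c i).2)
      = Fintype.piFinset (fun _ : Fin k =>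
        (univ : Finset (Fin n × Bool)).filter fun l => l.1 ∈ A ∧ v l.1 ≠ l.2) := by
    ext c
    simp [Fintype.mem_piFinset]
  rw [this, Fintype.card_piFinset_const, card_lits]

lemma card_unsat {n k : ℕ} (v : Assignment n) :
    ((univ : Finset (Clause n k)).filter fun c => ¬ SatClause v c).card = n ^ k := by
  have := card_cl (k := k) v (univ : Finset (Fin n))
  rw [Finset.card_univ, Fintype.card_fin] at this
  rw [← this]
  congr 1
  ext c
  simp [SatClause]

/-- Clauses satisfied by `a`. -/
noncomputable def SC {n : ℕ} (k : ℕ) (a : Assignment n) : Finset (Clause n k) :=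
  univ.filter fun c => SatClause a c

lemma card_SC {n k : ℕ} (a : Assignment n) : ((SC k a).card : ℝ) = n ^ k * (2 ^ k - 1) := by
  have h := Finset.card_filter_add_card_filter_not (s := (univ : Finset (Clause n k)))
    (fun c => SatClause a c)
  rw [card_unsat] at h
  have h2 : (univ : Finset (Clause n k)).card = (n * 2) ^ k := by
    simp [Finset.card_univ]
  rw [h2] at h
  have h3 : ((SC k a).card : ℝ) + n ^ k = (n * 2) ^ k := by
    unfold SC
    exact_mod_cast h
  rw [mul_pow] at h3
  linarith

lemma card_sat_unsat {n k : ℕ} (a : Assignment n) (D : Finset (Fin n)) :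
    (((SC k a).filter fun c => ¬ SatClause (flipAt a D) c).card : ℝ)
      = n ^ k - ((n : ℝ) - D.card) ^ k := by
  have h := Finset.card_filter_add_card_filter_not
    (s := (univ : Finset (Clause n k)).filter fun c => ¬ SatClause (flipAt a D) c)
    (fun c => SatClause a c)
  rw [card_unsat] at h
  have h1 : ((univ : Finset (Clause n k)).filter fun c => ¬ SatClause (flipAt a D) c).filter
      (fun c => SatClause a c) = (SC k a).filter fun c => ¬ SatClause (flipAt a D) c := by
    ext c
    simp [SC, and_comm]
  have h2 : ((univ : Finset (Clause n k)).filter fun c => ¬ SatClause (flipAt a D) c).filter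
      (fun c => ¬ SatClause a c)
      = (univ : Finset (Clause n k)).filter fun c => ∀ i, (c i).1 ∈ Dᶜ ∧ a (c i).1 ≠ (c i).2 := by
    ext c
    simp only [SatClause, mem_filter, mem_univ, true_and, not_exists, mem_compl, flipAt]
    constructor
    · rintro ⟨h1, h2⟩ i
      refine ⟨fun hi => ?_, h2 i⟩
      have h3 := h1 i
      have h4 := h2 i
      rw [if_pos hi] at h3
      cases hh : a (c i).1 <;> cases hh' : (c i).2 <;> simp_all
    · intro h
      refine ⟨fun i => ?_, fun i => (h i).2⟩
      rw [if_neg (h i).1]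
      exact (h i).2
  rw [h1, h2, card_cl, card_compl, Fintype.card_fin] at h
  have hD : D.card ≤ n := by simpa using Finset.card_le_univ D
  have h3 : ((((SC k a).filter fun c => ¬ SatClause (flipAt a D) c).card : ℝ))
      + ((n : ℝ) - D.card) ^ k = n ^ k := by
    rw [← Nat.cast_sub hD]
    exact_mod_cast h
  linarith

/-- number of `D` of size `t` whose flip violates `c`. -/
noncomputable def wt {n k : ℕ} (t : ℕ) (a : Assignment n) (c : Clause n k) : ℕ :=
  ((powersetCard t (univ : Finset (Fin n))).filter fun D => ¬ SatClause (flipAt a D) c).card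

lemma wt_le {n k : ℕ} (t : ℕ) (ht : 0 < t) (hn : 0 < n) (a : Assignment n) (c : Clause n k)
    (hc : SatClause a c) : (wt t a c : ℝ) * n ≤ t * n.choose t := by
  obtain ⟨i, hi⟩ := hc
  have h1 : wt t a c ≤ ((powersetCard t (univ : Finset (Fin n))).filter
      fun D => (c i).1 ∈ D).card := by
    unfold wt
    apply card_le_card
    intro D hD
    rw [mem_filter] at hD ⊢
    refine ⟨hD.1, ?_⟩
    by_contra hcon
    apply hD.2
    refine ⟨i, ?_⟩
    simp [flipAt, hcon, hi]
  have h2 : ((powersetCard t (univ : Finset (Fin n))).filter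
      fun D => (c i).1 ∈ D).card ≤ (n - 1).choose (t - 1) := by
    have : (powersetCard (t - 1) ((univ : Finset (Fin n)).erase (c i).1)).card
        = (n - 1).choose (t - 1) := by
      rw [card_powersetCard, card_erase_of_mem (mem_univ _), Finset.card_univ, Fintype.card_fin]
    rw [← this]
    apply card_le_card_of_injOn (fun D => D.erase (c i).1)
    · intro D hD
      simp only [coe_filter, mem_powersetCard, Set.mem_ofPred_eq] at hD
      simp only [mem_coe, mem_powersetCard]
      refine ⟨erase_subset_erase _ (subset_univ _), ?_⟩
      rw [card_erase_of_mem hD.2, hD.1.2]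
    · intro D hD D' hD' h
      simp only [coe_filter, mem_powersetCard, Set.mem_ofPred_eq] at hD hD'
      simp only at h
      rw [← insert_erase hD.2, ← insert_erase hD'.2, h]
  have h3 : n * (n - 1).choose (t - 1) = n.choose t * t := by
    obtain ⟨n', rfl⟩ := Nat.exists_eq_succ_of_ne_zero hn.ne'
    obtain ⟨t', rfl⟩ := Nat.exists_eq_succ_of_ne_zero ht.ne'
    exact Nat.add_one_mul_choose_eq n' t'
  have h4 : wt t a c * n ≤ t * n.choose t := by
    calc wt t a c * n ≤ (n - 1).choose (t - 1) * n := Nat.mul_le_mul_right _ (h1.trans h2)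
      _ = t * n.choose t := by rw [mul_comm, h3, mul_comm]
  exact_mod_cast h4

lemma sum_wt {n k : ℕ} (t : ℕ) (a : Assignment n) :
    ∑ c ∈ SC k a, (wt t a c : ℝ) = n.choose t * ((n : ℝ) ^ k - ((n : ℝ) - t) ^ k) := by
  have h1 : ∑ c ∈ SC k a, wt t a c = ∑ D ∈ powersetCard t (univ : Finset (Fin n)),
      ((SC k a).filter fun c => ¬ SatClause (flipAt a D) c).card := by
    unfold wt
    simp only [card_filter]
    rw [sum_comm]
  have h2 : ∑ c ∈ SC k a, (wt t a c : ℝ) = ∑ D ∈ powersetCard t (univ : Finset (Fin n)),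
      (((SC k a).filter fun c => ¬ SatClause (flipAt a D) c).card : ℝ) := by
    exact_mod_cast h1
  rw [h2, Finset.sum_congr rfl (g := fun _ => (n : ℝ) ^ k - ((n : ℝ) - t) ^ k)]
  · simp [mul_sub]
  · intro D hD
    rw [card_sat_unsat, (mem_powersetCard.mp hD).2]

lemma sum_numUnsat {n k m : ℕ} (t : ℕ) (a : Assignment n) (φ : Formula n k m) :
    ∑ D ∈ powersetCard t (univ : Finset (Fin n)), numUnsat φ (flipAt a D)
      = ∑ j, wt t a (φ j) := by
  unfold wt numUnsat
  simp only [card_filter]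
  rw [sum_comm]

lemma numSat_add {n k m : ℕ} (φ : Formula n k m) (v : Assignment n) :
    (numSat φ v : ℝ) + numUnsat φ v = m := by
  have h := Finset.card_filter_add_card_filter_not (s := (univ : Finset (Fin m)))
    (fun j => SatClause v (φ j))
  rw [Finset.card_univ, Fintype.card_fin] at h
  unfold numSat numUnsat
  exact_mod_cast h

/-- Formulas satisfied by `a`. -/
noncomputable def SF {n : ℕ} (k m : ℕ) (a : Assignment n) : Finset (Formula n k m) :=
  Fintype.piFinset fun _ => SC k a

lemma mem_SF {n k m : ℕ} (a : Assignment n) (φ : Formula n k m) :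
    φ ∈ SF k m a ↔ SatFormula a φ := by
  simp [SF, SC, SatFormula, Fintype.mem_piFinset]

lemma card_SF {n k m : ℕ} (a : Assignment n) :
    ((SF k m a).card : ℝ) = ((n : ℝ) ^ k * (2 ^ k - 1)) ^ m := by
  rw [SF, Fintype.card_piFinset_const, Nat.cast_pow, card_SC]

/-- Chernoff bound for a product space with weights in `[0,1]`. -/
lemma chernoff {ι : Type*} (S : Finset ι) (m : ℕ) (w : ι → ℝ)
    (hw0 : ∀ c ∈ S, 0 ≤ w c) (hw1 : ∀ c ∈ S, w c ≤ 1) (p : ℝ)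
    (hp : ∑ c ∈ S, w c = p * S.card) (x : ℝ) (hx0 : 0 ≤ x) (hx1 : x ≤ 1) :
    (((Fintype.piFinset fun _ : Fin m => S).filter
      fun φ => (1 + x / 2) * (m * p) < ∑ j, w (φ j)).card : ℝ)
      ≤ (S.card : ℝ) ^ m * Real.exp (-(x ^ 2 / 16 * (m * p))) := by
  set l := x / 4 with hl
  have hexp : Real.exp l ≤ 1 + l + l ^ 2 := by
    have := Real.abs_exp_sub_one_sub_id_le (x := l) (by rw [abs_le]; constructor <;> linarith)
    have := (abs_le.mp this).2
    linarith
  have hpt : ∀ c ∈ S, Real.exp (l * w c) ≤ 1 + w c * (l + l ^ 2) := by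
    intro c hc
    have hcv := convexOn_exp.2 (Set.mem_univ 0) (Set.mem_univ l)
      (sub_nonneg.mpr (hw1 c hc)) (hw0 c hc) (by ring)
    simp only [smul_eq_mul, mul_zero, zero_add, Real.exp_zero, mul_one] at hcv
    rw [mul_comm l]
    nlinarith [hw0 c hc, mul_le_mul_of_nonneg_left hexp (hw0 c hc)]
  have hsum : ∑ c ∈ S, Real.exp (l * w c) ≤ S.card * Real.exp (p * (l + l ^ 2)) := by
    calc ∑ c ∈ S, Real.exp (l * w c) ≤ ∑ c ∈ S, (1 + w c * (l + l ^ 2)) := sum_le_sum hpt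
      _ = S.card * (p * (l + l ^ 2) + 1) := by
        rw [sum_add_distrib, ← sum_mul, hp]; simp; ring
      _ ≤ _ := by
        gcongr
        exact Real.add_one_le_exp _
  have hprod : ∑ φ ∈ Fintype.piFinset (fun _ : Fin m => S), Real.exp (l * ∑ j, w (φ j))
      = (∑ c ∈ S, Real.exp (l * w c)) ^ m := by
    have := Finset.prod_univ_sum (fun _ : Fin m => S) (fun _ c => Real.exp (l * w c))
    rw [Finset.prod_const, Finset.card_univ, Fintype.card_fin] at this
    rw [this]
    apply sum_congr rfl
    intro φ _
    rw [mul_sum, Real.exp_sum]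
  have hmk : (((Fintype.piFinset fun _ : Fin m => S).filter
      fun φ => (1 + x / 2) * (m * p) < ∑ j, w (φ j)).card : ℝ)
        * Real.exp (l * ((1 + x / 2) * (m * p)))
      ≤ ∑ φ ∈ Fintype.piFinset (fun _ : Fin m => S), Real.exp (l * ∑ j, w (φ j)) := by
    rw [← nsmul_eq_mul, ← sum_const]
    refine le_trans (sum_le_sum (g := fun φ => Real.exp (l * ∑ j, w (φ j))) ?_) ?_
    · intro φ hφ
      have := (mem_filter.mp hφ).2
      apply Real.exp_le_exp.mpr
      exact mul_le_mul_of_nonneg_left this.le (by positivity)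
    · exact sum_le_sum_of_subset_of_nonneg (filter_subset _ _) fun _ _ _ => (Real.exp_pos _).le
  have h2 : (∑ c ∈ S, Real.exp (l * w c)) ^ m ≤ (S.card : ℝ) ^ m * Real.exp (m * (p * (l + l ^ 2))) := by
    rw [Real.exp_nat_mul, ← mul_pow]
    exact pow_le_pow_left₀ (sum_nonneg fun _ _ => (Real.exp_pos _).le) hsum m
  rw [hprod] at hmk
  have h3 := hmk.trans h2
  rw [← le_div_iff₀ (Real.exp_pos _), mul_div_assoc, ← Real.exp_sub] at h3
  refine h3.trans (le_of_eq ?_)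
  congr 2
  rw [hl]
  ring

lemma one_sub_pow_ge (α : ℝ) (h0 : 0 ≤ α) (h1 : α < 1 / 2) (k : ℕ) :
    2 * α * (2 ^ k - 1) ≤ (1 - (1 - α) ^ k) * 2 ^ k := by
  have e1 := mul_neg_geom_sum (1 - α) k
  have e2 := mul_neg_geom_sum (1 / 2 : ℝ) k
  have hle : ∑ i ∈ range k, (1 / 2 : ℝ) ^ i ≤ ∑ i ∈ range k, (1 - α) ^ i := by
    gcongr with i _
    linarith
  have e3 : (1 / 2 : ℝ) ^ k * 2 ^ k = 1 := by rw [← mul_pow]; norm_num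
  have h2 : (0 : ℝ) < 2 ^ k := by positivity
  have : 2 * α * (1 - (1 / 2) ^ k) ≤ 1 - (1 - α) ^ k := by
    rw [← e1, ← e2]
    have := mul_le_mul_of_nonneg_left hle h0
    nlinarith
  have := mul_le_mul_of_nonneg_right this h2.le
  calc _ = 2 * α * (1 - (1 / 2) ^ k) * 2 ^ k := by rw [mul_assoc _ (1 - _), sub_mul, e3]; ring
    _ ≤ _ := this

lemma markov_half {ι : Type*} (s : Finset ι) (f : ι → ℝ) (hf : ∀ i ∈ s, 0 ≤ f i) (M x : ℝ)
    (hM : 0 < M) (hx0 : 0 ≤ x) (hx1 : x ≤ 1)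
    (h : ∑ i ∈ s, f i ≤ s.card * ((1 + x / 2) * M)) :
    x / 4 * s.card ≤ ((s.filter fun i => f i ≤ (1 + x) * M).card : ℝ) := by
  have h1 : ((s.filter fun i => f i ≤ (1 + x) * M).card : ℝ)
      + ((s.filter fun i => ¬ f i ≤ (1 + x) * M).card : ℝ) = s.card := by
    exact_mod_cast Finset.card_filter_add_card_filter_not (s := s) (fun i => f i ≤ (1 + x) * M)
  have h2 : ((s.filter fun i => ¬ f i ≤ (1 + x) * M).card : ℝ) * ((1 + x) * M)
      ≤ ∑ i ∈ s, f i := by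
    rw [← nsmul_eq_mul, ← sum_const]
    refine le_trans (sum_le_sum (g := f) ?_) ?_
    · intro i hi
      exact (not_le.mp (mem_filter.mp hi).2).le
    · exact sum_le_sum_of_subset_of_nonneg (filter_subset _ _) fun i hi _ => hf i hi
  set B := ((s.filter fun i => ¬ f i ≤ (1 + x) * M).card : ℝ)
  have h3 : B * (1 + x) ≤ s.card * (1 + x / 2) := by
    have := h2.trans h
    rw [← mul_assoc, ← mul_assoc] at this
    exact le_of_mul_le_mul_right this hM
  have hs : (0 : ℝ) ≤ s.card := by positivity
  have h4 : B ≤ s.card * (1 - x / 4) := by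
    have : B * (1 + x) ≤ s.card * (1 - x / 4) * (1 + x) := by
      refine h3.trans ?_
      rw [mul_assoc]
      apply mul_le_mul_of_nonneg_left _ hs
      nlinarith
    exact le_of_mul_le_mul_right this (by linarith)
  linarith

lemma hit_count {n : ℕ} (N : ℕ) (H : Finset (Assignment n)) (y : ℝ)
    (hy : y ≤ N * (H.card / (2 : ℝ) ^ n)) :
    ((2 : ℝ) ^ n) ^ N * (1 - Real.exp (-y)) ≤
      (((univ : Finset (Fin N → Assignment n)).filter fun s => ∃ i, s i ∈ H).card : ℝ) := by
  have h1 : (((univ : Finset (Fin N → Assignment n)).filter fun s => ∃ i, s i ∈ H).card : ℝ)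
      + (((univ : Finset (Fin N → Assignment n)).filter fun s => ¬ ∃ i, s i ∈ H).card : ℝ)
      = ((2 : ℝ) ^ n) ^ N := by
    have := Finset.card_filter_add_card_filter_not (s := (univ : Finset (Fin N → Assignment n)))
      (fun s => ∃ i, s i ∈ H)
    have h2 : (univ : Finset (Fin N → Assignment n)).card = (2 ^ n) ^ N := by
      simp [Finset.card_univ]
    rw [h2] at this
    exact_mod_cast this
  have h2 : ((univ : Finset (Fin N → Assignment n)).filter fun s => ¬ ∃ i, s i ∈ H)
      = Fintype.piFinset fun _ => Hᶜ := by
    ext s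
    simp [Fintype.mem_piFinset]
  have hH : H.card ≤ 2 ^ n := by
    simpa using Finset.card_le_univ H
  have hH' : (H.card : ℝ) ≤ 2 ^ n := by exact_mod_cast hH
  have h3 : ((Hᶜ.card : ℕ) : ℝ) = 2 ^ n * (1 - H.card / (2 : ℝ) ^ n) := by
    rw [card_compl, Nat.cast_sub (Finset.card_le_univ H)]
    have : Fintype.card (Assignment n) = 2 ^ n := by simp
    rw [this]
    push_cast
    field_simp
  have h4 : (((univ : Finset (Fin N → Assignment n)).filter fun s => ¬ ∃ i, s i ∈ H).card : ℝ)
      ≤ ((2 : ℝ) ^ n) ^ N * Real.exp (-y) := by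
    rw [h2, Fintype.card_piFinset_const, Nat.cast_pow, h3, mul_pow]
    gcongr
    have h5 : 0 ≤ 1 - (H.card : ℝ) / 2 ^ n := by
      rw [sub_nonneg, div_le_one (by positivity)]
      exact hH'
    calc (1 - (H.card : ℝ) / 2 ^ n) ^ N ≤ (Real.exp (-((H.card : ℝ) / 2 ^ n))) ^ N := by
          gcongr
          linarith [Real.add_one_le_exp (-((H.card : ℝ) / 2 ^ n))]
      _ = Real.exp (-(N * (H.card / (2 : ℝ) ^ n))) := by
          rw [← Real.exp_nat_mul]; congr 1; ring
      _ ≤ _ := by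
          apply Real.exp_le_exp.mpr
          linarith
  linarith

lemma card_filter_prod_ge {A B : Type*} (S G : Finset A) (U : Finset B) (hG : G ⊆ S)
    (P : A × B → Prop) [DecidablePred P] (r : ℝ)
    (h : ∀ a ∈ G, r ≤ ((U.filter fun b => P (a, b)).card : ℝ)) :
    G.card * r ≤ (((S ×ˢ U).filter P).card : ℝ) := by
  have h1 : (((S ×ˢ U).filter P).card : ℝ) = ∑ a ∈ S, ((U.filter fun b => P (a, b)).card : ℝ) := by
    have : ((S ×ˢ U).filter P).card = ∑ a ∈ S, (U.filter fun b => P (a, b)).card := by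
      simp only [card_filter]
      rw [sum_product]
    exact_mod_cast this
  rw [h1, ← nsmul_eq_mul, ← sum_const]
  exact (sum_le_sum h).trans
    (sum_le_sum_of_subset_of_nonneg hG fun _ _ _ => Nat.cast_nonneg _)

set_option maxHeartbeats 2000000

/-- Let `k ≥ 60`, `m = (ln 2·2^k − c)n` with `c < ln 2·2^k/2`, `0 ≤ α < 1/2`
with `αn = t` a positive integer, and let `p_sat > 0` be the probability that a uniformly
random formula with `m` clauses is satisfiable.  Draw `φ` uniformly among satisfiable formulas
and, independently, a sequence of `⌈2n²2ⁿ/C(n,αn)⌉` i.i.d. uniform assignments.  Then with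
probability at least `1 − e^{cn/2^k}·2·e^{−(1−α)^{2k}·ln 2·n/16}/p_sat − e^{−n²}`, some sampled
assignment `h` simultaneously (a) is within Hamming distance `αn` of some satisfying
assignment of `φ` and (b) satisfies at least `(1−(1−(1−α)^{2k})/(2^k−1))m` clauses of `φ`. -/
theorem true_positive_in_samples (n k m : ℕ) (hn : 0 < n) (hk : 60 ≤ k) (hm : 0 < m)
    (c : ℝ) (hc : c < Real.log 2 * 2 ^ k / 2)
    (hmval : (m : ℝ) = (Real.log 2 * 2 ^ k - c) * n)
    (α : ℝ) (hα0 : 0 ≤ α) (hα1 : α < 1 / 2) (t : ℕ) (ht0 : 0 < t) (ht : (t : ℝ) = α * n)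
    (psat : ℝ)
    (hpsat : psat = (((univ : Finset (Formula n k m)).filter fun φ =>
        ∃ a : Assignment n, SatFormula a φ).card : ℝ) / (Fintype.card (Formula n k m) : ℝ))
    (hpsat0 : 0 < psat) :
    let N : ℕ := ⌈(2 * (n : ℝ) ^ 2 * 2 ^ n) / (n.choose t : ℝ)⌉₊
    let Sat : Finset (Formula n k m) := univ.filter fun φ => ∃ a : Assignment n, SatFormula a φ
    let T : ℝ := (1 - (1 - (1 - α) ^ (2 * k)) / (2 ^ k - 1)) * m
    ((((Sat ×ˢ (univ : Finset (Fin N → Assignment n))).filter fun p =>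
        ∃ i : Fin N, ∃ a : Assignment n, SatFormula a p.1 ∧
          hammingDist (p.2 i) a ≤ t ∧ T ≤ (numSat p.1 (p.2 i) : ℝ)).card : ℝ)
        / ((Sat.card : ℝ) * ((2 : ℝ) ^ n) ^ N))
      ≥ 1 - Real.exp (c * n / 2 ^ k) * 2
            * Real.exp (-(1 - α) ^ (2 * k) * Real.log 2 * n / 16) / psat
          - Real.exp (-(n : ℝ) ^ 2) := by
  intro N Sat T
  set x : ℝ := (1 - α) ^ k with hx
  have hnR : (0 : ℝ) < n := by exact_mod_cast hn
  have hn1 : (1 : ℝ) ≤ n := by exact_mod_cast hn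
  have htR : (0 : ℝ) < t := by exact_mod_cast ht0
  have hmR : (0 : ℝ) < m := by exact_mod_cast hm
  have hα : 0 < α := by
    by_contra hcon
    have : α = 0 := le_antisymm (not_lt.mp hcon) hα0
    rw [this] at ht
    linarith
  have hkne : k ≠ 0 := by omega
  have hx0 : 0 < x := pow_pos (by linarith) k
  have hx1 : x < 1 := pow_lt_one₀ (by linarith) (by linarith) hkne
  have hx2 : (1 - α) ^ (2 * k) = x ^ 2 := by rw [hx, ← pow_mul, mul_comm]
  have h2k : (1 : ℝ) < 2 ^ k := one_lt_pow₀ (by norm_num) hkne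
  have h2k1 : (0 : ℝ) < 2 ^ k - 1 := by linarith
  have hlog : 0 < Real.log 2 := Real.log_pos (by norm_num)
  have htn : t ≤ n := by
    have : (t : ℝ) ≤ n := by rw [ht]; nlinarith
    exact_mod_cast this
  set C : ℝ := (n.choose t : ℝ) with hC
  have hC0 : 0 < C := by
    rw [hC]; exact_mod_cast Nat.choose_pos htn
  set E : ℝ := x ^ 2 / 16 * (Real.log 2 * n) with hE
  set p : ℝ := (1 - x) / (α * (2 ^ k - 1)) with hp
  have hp0 : 0 < p := div_pos (by linarith) (by positivity)
  have hmp : Real.log 2 * n ≤ m * p := by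
    have h1 : Real.log 2 * 2 ^ k / 2 * n ≤ m := by
      rw [hmval]
      apply mul_le_mul_of_nonneg_right _ hnR.le
      linarith
    have h2 : 2 * (2 ^ k - 1) / 2 ^ k / (2 ^ k - 1) ≤ p := by
      have h3 := one_sub_pow_ge α hα0 hα1 k
      rw [hp, div_div, div_le_div_iff₀ (by positivity) (by positivity)]
      have := mul_le_mul_of_nonneg_right h3 h2k1.le
      rw [← hx] at this
      nlinarith
    calc Real.log 2 * n = Real.log 2 * 2 ^ k / 2 * n * (2 * (2 ^ k - 1) / 2 ^ k / (2 ^ k - 1)) := by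
          field_simp
      _ ≤ m * p := by
          apply mul_le_mul h1 h2 (by positivity) hmR.le
  -- the normalised weight
  let w : Assignment n → Clause n k → ℝ := fun a cl => (wt t a cl : ℝ) / (α * C)
  have hw0 : ∀ a cl, 0 ≤ w a cl := fun a cl => by positivity
  have hw1 : ∀ a, ∀ cl ∈ SC k a, w a cl ≤ 1 := by
    intro a cl hcl
    have := wt_le t ht0 hn a cl (by simpa [SC] using hcl)
    rw [ht] at this
    show _ / _ ≤ _
    rw [div_le_one (by positivity)]
    have h2 : (wt t a cl : ℝ) * n ≤ (α * C) * n := by linarith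
    exact le_of_mul_le_mul_right h2 hnR
  have hws : ∀ a, ∑ cl ∈ SC k a, w a cl = p * (SC k a).card := by
    intro a
    show ∑ cl ∈ SC k a, (wt t a cl : ℝ) / (α * C) = _
    rw [← sum_div, sum_wt, card_SC, ← hC, hp]
    have : ((n : ℝ) - t) ^ k = n ^ k * x := by
      rw [hx, ← mul_pow, ht]; congr 1; ring
    rw [this]
    field_simp
  let Bad : Assignment n → Finset (Formula n k m) := fun a =>
    (SF k m a).filter fun φ => (1 + x / 2) * (m * p) < ∑ j, w a (φ j)
  set Q : ℝ := ((n : ℝ) ^ k * (2 ^ k - 1)) ^ m with hQ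
  have hBad : ∀ a, ((Bad a).card : ℝ) ≤ Q * Real.exp (-E) := by
    intro a
    have h1 := chernoff (SC k a) m (w a) (fun cl _ => hw0 a cl) (hw1 a) p (hws a) x hx0.le hx1.le
    rw [card_SC] at h1
    refine h1.trans ?_
    apply mul_le_mul_of_nonneg_left _ (by positivity)
    apply Real.exp_le_exp.mpr
    have := mul_le_mul_of_nonneg_left hmp (show 0 ≤ x ^ 2 / 16 by positivity)
    linarith
  let BadS : Finset (Formula n k m) := (univ : Finset (Assignment n)).biUnion Bad
  have hcA : ((univ : Finset (Assignment n)).card : ℝ) = 2 ^ n := by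
    have : (univ : Finset (Assignment n)).card = 2 ^ n := by simp [Finset.card_univ]
    exact_mod_cast this
  have hBadS : (BadS.card : ℝ) ≤ 2 ^ n * Q * Real.exp (-E) := by
    calc (BadS.card : ℝ) ≤ ∑ a : Assignment n, ((Bad a).card : ℝ) := by
          exact_mod_cast card_biUnion_le
      _ ≤ ∑ a : Assignment n, Q * Real.exp (-E) := sum_le_sum fun a _ => hBad a
      _ = _ := by rw [sum_const, nsmul_eq_mul, hcA, mul_assoc]
  have hSatle : (Sat.card : ℝ) ≤ 2 ^ n * Q := by
    have hsub : Sat ⊆ (univ : Finset (Assignment n)).biUnion (SF k m) := by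
      intro φ hφ
      obtain ⟨a, ha⟩ := (mem_filter.mp hφ).2
      exact mem_biUnion.mpr ⟨a, mem_univ _, (mem_SF a φ).mpr ha⟩
    calc (Sat.card : ℝ) ≤ (((univ : Finset (Assignment n)).biUnion (SF k m)).card : ℝ) := by
          exact_mod_cast card_le_card hsub
      _ ≤ ∑ a : Assignment n, ((SF k m a).card : ℝ) := by
          exact_mod_cast card_biUnion_le
      _ = _ := by simp only [card_SF]; rw [sum_const, nsmul_eq_mul, hcA]
  set F : ℝ := (Fintype.card (Formula n k m) : ℝ) with hF
  have hFval : F = ((n : ℝ) ^ k * 2 ^ k) ^ m := by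
    rw [hF]; simp [mul_pow]
  have hF0 : 0 < F := by rw [hFval]; positivity
  have hQF : 2 ^ n * Q ≤ F * Real.exp (c * n / 2 ^ k) := by
    have h1 : Q = F * (1 - 1 / 2 ^ k) ^ m := by
      rw [hFval, hQ, ← mul_pow]; congr 1; field_simp
    have h2 : (1 - 1 / 2 ^ k : ℝ) ^ m ≤ Real.exp (-(m / 2 ^ k)) := by
      have h0 : (0 : ℝ) ≤ 1 - 1 / 2 ^ k := by
        rw [sub_nonneg, div_le_one (by positivity)]; exact h2k.le
      calc (1 - 1 / 2 ^ k : ℝ) ^ m ≤ (Real.exp (-(1 / 2 ^ k))) ^ m := by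
            gcongr
            linarith [Real.add_one_le_exp (-(1 / 2 ^ k : ℝ))]
        _ = _ := by rw [← Real.exp_nat_mul]; congr 1; ring
    have h3 : (2 : ℝ) ^ n = Real.exp (n * Real.log 2) := by
      rw [Real.exp_nat_mul, Real.exp_log (by norm_num)]
    have h4 : (2 : ℝ) ^ n * Real.exp (-(m / 2 ^ k)) = Real.exp (c * n / 2 ^ k) := by
      rw [h3, ← Real.exp_add, hmval]
      congr 1
      field_simp
      ring
    calc 2 ^ n * Q = F * (2 ^ n * (1 - 1 / 2 ^ k) ^ m) := by rw [h1]; ring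
      _ ≤ F * (2 ^ n * Real.exp (-(m / 2 ^ k))) := by gcongr
      _ = _ := by rw [h4]
  have hpsF : (Sat.card : ℝ) = psat * F := by
    rw [hpsat]; field_simp; rfl
  have hSat0 : 0 < (Sat.card : ℝ) := by rw [hpsF]; positivity
  set R : ℝ := Real.exp (c * n / 2 ^ k) / psat with hR
  have hR1 : 1 ≤ R := by
    rw [hR, le_div_iff₀ hpsat0, one_mul]
    have : F * psat ≤ F * Real.exp (c * n / 2 ^ k) := by
      linarith
    exact le_of_mul_le_mul_left this hF0
  have hBadR : (BadS.card : ℝ) ≤ Sat.card * (R * Real.exp (-E)) := by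
    refine hBadS.trans ?_
    calc 2 ^ n * Q * Real.exp (-E) ≤ F * Real.exp (c * n / 2 ^ k) * Real.exp (-E) := by
          gcongr
      _ = _ := by rw [hpsF, hR]; field_simp
  -- per-formula bound
  have hkey : ∀ φ ∈ Sat \ BadS, ((2 : ℝ) ^ n) ^ N * (1 - Real.exp (-E)) ≤
      (((univ : Finset (Fin N → Assignment n)).filter fun s =>
        ∃ i : Fin N, ∃ a : Assignment n, SatFormula a φ ∧
          hammingDist (s i) a ≤ t ∧ T ≤ (numSat φ (s i) : ℝ)).card : ℝ) := by
    intro φ hφ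
    rw [mem_sdiff] at hφ
    obtain ⟨a, ha⟩ := (mem_filter.mp hφ.1).2
    have hgood : ∑ j, w a (φ j) ≤ (1 + x / 2) * (m * p) := by
      by_contra hcon
      apply hφ.2
      exact mem_biUnion.mpr ⟨a, mem_univ _, mem_filter.mpr ⟨(mem_SF a φ).mpr ha, not_le.mp hcon⟩⟩
    set M : ℝ := m * (1 - x) / (2 ^ k - 1) with hM
    have hM0 : 0 < M := div_pos (mul_pos hmR (by linarith)) h2k1
    set PS := powersetCard t (univ : Finset (Fin n)) with hPS
    have hPSc : (PS.card : ℝ) = C := by simp [hPS, hC]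
    have hsum : ∑ D ∈ PS, (numUnsat φ (flipAt a D) : ℝ) ≤ PS.card * ((1 + x / 2) * M) := by
      have h1 : ∑ D ∈ PS, (numUnsat φ (flipAt a D) : ℝ) = ∑ j, (wt t a (φ j) : ℝ) := by
        exact_mod_cast sum_numUnsat t a φ
      have h2 : ∑ j, w a (φ j) = (∑ j, (wt t a (φ j) : ℝ)) / (α * C) := by
        rw [sum_div]
      rw [h2, div_le_iff₀ (by positivity)] at hgood
      rw [h1, hPSc]
      refine hgood.trans (le_of_eq ?_)
      rw [hM, hp]
      field_simp
    have hmk := markov_half PS (fun D => (numUnsat φ (flipAt a D) : ℝ)) (fun _ _ => by positivity)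
      M x hM0 hx0.le hx1.le hsum
    set G := PS.filter fun D => (numUnsat φ (flipAt a D) : ℝ) ≤ (1 + x) * M with hG
    set H : Finset (Assignment n) := G.image (flipAt a) with hH
    have hHc : H.card = G.card := card_image_of_injective _ (flipAt_inj a)
    have hy : E ≤ N * (H.card / (2 : ℝ) ^ n) := by
      have hN : (2 * (n : ℝ) ^ 2 * 2 ^ n) / C ≤ N := Nat.le_ceil _
      have hl1 : Real.log 2 ≤ 1 := by
        have := Real.log_le_sub_one_of_pos (show (0 : ℝ) < 2 by norm_num)
        linarith
      calc E ≤ x / 2 * (n * n) := by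
            rw [hE]
            have a1 : x ^ 2 / 16 ≤ x / 2 := by nlinarith
            have a2 : Real.log 2 * n ≤ n * n := by nlinarith
            exact mul_le_mul a1 a2 (by positivity) (by positivity)
        _ = (2 * (n : ℝ) ^ 2 * 2 ^ n) / C * (x / 4 * C / 2 ^ n) := by
            field_simp; norm_num
        _ ≤ _ := by
            rw [hHc]
            rw [hPSc] at hmk
            gcongr
    refine (hit_count N H E hy).trans ?_
    have : ((univ : Finset (Fin N → Assignment n)).filter fun s => ∃ i, s i ∈ H) ⊆
        ((univ : Finset (Fin N → Assignment n)).filter fun s =>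
        ∃ i : Fin N, ∃ a : Assignment n, SatFormula a φ ∧
          hammingDist (s i) a ≤ t ∧ T ≤ (numSat φ (s i) : ℝ)) := by
      intro s hs
      obtain ⟨i, hi⟩ := (mem_filter.mp hs).2
      refine mem_filter.mpr ⟨mem_univ _, i, a, ha, ?_⟩
      obtain ⟨D, hD, hDs⟩ := mem_image.mp hi
      rw [← hDs]
      obtain ⟨hD1, hD2⟩ := mem_filter.mp hD
      refine ⟨by rw [flipAt_dist, (mem_powersetCard.mp hD1).2], ?_⟩
      have h1 := numSat_add φ (flipAt a D)
      have h2 : T = m - (1 + x) * M := by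
        show (1 - (1 - (1 - α) ^ (2 * k)) / (2 ^ k - 1)) * (m : ℝ) = _
        rw [hx2, hM]
        field_simp
        ring
      linarith
    exact_mod_cast card_le_card this
  have hfin := card_filter_prod_ge Sat (Sat \ BadS) (univ : Finset (Fin N → Assignment n))
    sdiff_subset (fun p => ∃ i : Fin N, ∃ a : Assignment n, SatFormula a p.1 ∧
          hammingDist (p.2 i) a ≤ t ∧ T ≤ (numSat p.1 (p.2 i) : ℝ))
    (((2 : ℝ) ^ n) ^ N * (1 - Real.exp (-E))) (fun φ hφ => by convert hkey φ hφ)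
  have hsd : (Sat.card : ℝ) - BadS.card ≤ ((Sat \ BadS).card : ℝ) := by
    have := Finset.le_card_sdiff BadS Sat
    have h2 : Sat.card ≤ (Sat \ BadS).card + BadS.card := by omega
    have h3 : (Sat.card : ℝ) ≤ (Sat \ BadS).card + BadS.card := by exact_mod_cast h2
    linarith
  set e : ℝ := Real.exp (-E) with he
  have he0 : 0 < e := Real.exp_pos _
  have he1 : e ≤ 1 := by
    rw [he]; apply Real.exp_le_one_iff.mpr
    have : 0 ≤ E := by positivity
    linarith
  have heq : Real.exp (-(1 - α) ^ (2 * k) * Real.log 2 * n / 16) = e := by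
    rw [he, hx2, hE]; congr 1; ring
  have hrhs : 1 - Real.exp (c * n / 2 ^ k) * 2
            * Real.exp (-(1 - α) ^ (2 * k) * Real.log 2 * n / 16) / psat
          - Real.exp (-(n : ℝ) ^ 2) ≤ (1 - R * e) * (1 - e) := by
    rw [heq]
    have h1 : Real.exp (c * n / 2 ^ k) * 2 * e / psat = 2 * R * e := by
      rw [hR]; ring
    rw [h1]
    have := Real.exp_pos (-(n : ℝ) ^ 2)
    have h2 : e ≤ R * e := by nlinarith
    have h3 : 0 ≤ R * e * e := by positivity
    nlinarith
  rw [ge_iff_le]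
  refine hrhs.trans ?_
  have hKN : (0 : ℝ) < ((2 : ℝ) ^ n) ^ N := pow_pos (pow_pos two_pos n) N
  rw [le_div_iff₀ (mul_pos hSat0 hKN)]
  refine le_trans ?_ hfin
  have h1 : Sat.card * (1 - R * e) ≤ ((Sat \ BadS).card : ℝ) := by linarith
  calc (1 - R * e) * (1 - e) * (Sat.card * ((2 : ℝ) ^ n) ^ N)
      = Sat.card * (1 - R * e) * (((2 : ℝ) ^ n) ^ N * (1 - e)) := by ring
    _ ≤ _ := by
      apply mul_le_mul_of_nonneg_right h1
      exact mul_nonneg hKN.le (by linarith)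
end
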